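/- arXiv:math/0306416 — 3 statements merged into one kernel-verified Lean document; each statement's English description precedes it below -/
import Mathlib

section
/- Let k, l ≥ 2 be coprime integers with k + l = n, let α ∈ S_n be the permutation with cycle decomposition (1 2 ⋯ k)(k+1 k+2 ⋯ n), let π₁ = (1 2 ⋯ k) ∈ S_{n−1}, let π₂ ∈ S_{n−1} be any permutation such that {π₁, π₂} generates S_{n−1}, and define β ∈ T_n by β(i) = π₂(i) for 1 ≤ i ≤ n−1 and β(n) = π₂(1). Then U_{k,l} is a submonoid of T_n and it is generated by {α, β}. -/
/-- The submonoid of transformations of `Fin n` generated by `X`: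
all finite compositions of elements of `X` (including the identity). -/
def MGen {n : ℕ} (X : Set (Fin n → Fin n)) : Set (Fin n → Fin n) :=
  {f | ∃ l : List (Fin n → Fin n), (∀ g ∈ l, g ∈ X) ∧ f = l.foldr (· ∘ ·) id}

/-- The rank of a transformation: the number of elements of its image. -/
def rank {n : ℕ} (f : Fin n → Fin n) : ℕ := (Finset.image f Finset.univ).card

/-- The permutation of `Z_n = {1,…,n}` (coded as `Fin n`, with `i : Fin n` standing for
`i+1 ∈ Z_n`) with cycle decomposition `(1 2 ⋯ k)(k+1 k+2 ⋯ n)`. -/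
def twoCycle (n k : ℕ) (i : Fin n) : Fin n :=
  ⟨(if i.val + 1 = k then 0 else if i.val + 1 = n then k else i.val + 1) % n,
    Nat.mod_lt _ i.pos⟩

/-- The set `U_{k,l} ⊆ T_n` (with `l = n - k`): all `γ` such that exactly one of the
following holds: (1) `γ = α^m` for some `m ≥ 1`, where `α = (1 ⋯ k)(k+1 ⋯ n)`;
(2) `γ(i) = γ(j)` for some `i ∈ {1,…,k}`, `j ∈ {k+1,…,n}`, and some
`m ∈ {k+1,…,n}` is not in the image of `γ`. -/
def Ukl (n k : ℕ) : Set (Fin n → Fin n) :=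
  {γ | Xor'
    (∃ m : ℕ, 1 ≤ m ∧ γ = (twoCycle n k)^[m])
    ((∃ i j : Fin n, i.val < k ∧ k ≤ j.val ∧ γ i = γ j) ∧
      ∃ m : Fin n, k ≤ m.val ∧ m ∉ Set.range γ)}

/-- The permutation `(1 2 ⋯ k)` of `Z_m` (coded on `Fin m`), fixing `k+1, …, m`. -/
def kCycle (m k : ℕ) (i : Fin m) : Fin m :=
  ⟨(if i.val + 1 = k then 0 else if i.val + 1 < k then i.val + 1 else i.val) % m,
    Nat.mod_lt _ i.pos⟩

/-- The transformation `β ∈ T_n` given by `β(i) = π₂(i)` for `1 ≤ i ≤ n-1` and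
`β(n) = π₂(1)`, where `π₂` is a permutation of `Z_{n-1}`. -/
def betaOf (n : ℕ) (π₂ : Fin (n - 1) → Fin (n - 1)) (i : Fin n) : Fin n :=
  if h : i.val < n - 1 then Fin.castLE (Nat.sub_le n 1) (π₂ ⟨i.val, h⟩)
  else if h2 : 0 < n - 1 then Fin.castLE (Nat.sub_le n 1) (π₂ ⟨0, h2⟩) else i

theorem MGen_id {n : ℕ} (X : Set (Fin n → Fin n)) : id ∈ MGen X :=
  ⟨[], by simp, rfl⟩

theorem MGen_cons {n : ℕ} {X : Set (Fin n → Fin n)} {f g : Fin n → Fin n}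
    (hf : f ∈ X) (hg : g ∈ MGen X) : f ∘ g ∈ MGen X := by
  obtain ⟨l, hl, rfl⟩ := hg
  refine ⟨f :: l, ?_, rfl⟩
  intro h hh
  rcases List.mem_cons.1 hh with rfl | hh
  · exact hf
  · exact hl _ hh

theorem MGen_induct {n : ℕ} {X : Set (Fin n → Fin n)} {P : (Fin n → Fin n) → Prop}
    (h1 : P id) (h2 : ∀ f ∈ X, ∀ g, P g → P (f ∘ g)) : ∀ f ∈ MGen X, P f := by
  rintro f ⟨l, hl, rfl⟩
  induction l with
  | nil => exact h1
  | cons a l ih =>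
    exact h2 a (hl a (by simp)) _ (ih (fun g hg => hl g (by simp [hg])))

theorem MGen_comp {n : ℕ} {X : Set (Fin n → Fin n)} {f g : Fin n → Fin n}
    (hf : f ∈ MGen X) (hg : g ∈ MGen X) : f ∘ g ∈ MGen X := by
  refine MGen_induct (P := fun f => f ∘ g ∈ MGen X) hg ?_ f hf
  intro a ha b hb
  exact MGen_cons (g := b ∘ g) ha hb

theorem MGen_of {n : ℕ} {X : Set (Fin n → Fin n)} {f : Fin n → Fin n}
    (hf : f ∈ X) : f ∈ MGen X := MGen_cons hf (MGen_id X)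

theorem MGen_iter {n : ℕ} {X : Set (Fin n → Fin n)} {f : Fin n → Fin n}
    (hf : f ∈ X) (t : ℕ) : f^[t] ∈ MGen X := by
  induction t with
  | zero => exact MGen_id X
  | succ t ih => rw [Function.iterate_succ']; exact MGen_cons hf ih

theorem succ_mod_aux (a k : ℕ) (hk : 0 < k) :
    (a + 1) % k = if a % k + 1 = k then 0 else a % k + 1 := by
  have h := Nat.mod_lt a hk
  rw [Nat.add_mod]
  split_ifs with h1
  · rcases Nat.lt_or_ge 1 k with h2 | h2
    · rw [Nat.mod_eq_of_lt h2, h1, Nat.mod_self]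
    · have : k = 1 := by omega
      subst this; simp [Nat.mod_one]
  · have h2 : 1 < k := by omega
    rw [Nat.mod_eq_of_lt h2, Nat.mod_eq_of_lt (by omega)]

theorem iter_val (n k l : ℕ) (hk : 2 ≤ k) (hl : 2 ≤ l) (hn : k + l = n) (t : ℕ) (x : Fin n) :
    (((twoCycle n k)^[t]) x).val =
      if x.val < k then (x.val + t) % k else k + (x.val - k + t) % l := by
  have hx := x.isLt
  induction t with
  | zero =>
    simp only [Function.iterate_zero, id, add_zero]
    split_ifs with h
    · rw [Nat.mod_eq_of_lt h]
    · rw [Nat.mod_eq_of_lt (by omega)]; omega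
  | succ t ih =>
    rw [Function.iterate_succ_apply']
    simp only [twoCycle, ih]
    split_ifs at * with h
    all_goals
      have h1 := Nat.mod_lt (x.val + t) (show 0 < k by omega)
      have h2 := Nat.mod_lt (x.val - k + t) (show 0 < l by omega)
      have h3 := succ_mod_aux (x.val + t) k (by omega)
      have h4 := succ_mod_aux (x.val - k + t) l (by omega)
      rw [← add_assoc]
      first
      | rw [h3]
      | rw [h4]
      split_ifs <;> rw [Nat.mod_eq_of_lt (by omega)] <;> omega

theorem iter_period (n k l : ℕ) (hk : 2 ≤ k) (hl : 2 ≤ l) (hn : k + l = n) (t : ℕ) :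
    (twoCycle n k)^[k * l * t] = id := by
  funext x
  have hx := x.isLt
  apply Fin.ext
  rw [iter_val n k l hk hl hn]
  simp only [id]
  split_ifs with h
  · rw [mul_assoc, Nat.add_mul_mod_self_left, Nat.mod_eq_of_lt h]
  · rw [mul_comm k l, mul_assoc, Nat.add_mul_mod_self_left, Nat.mod_eq_of_lt (by omega)]; omega

theorem iter_inv (n k l : ℕ) (hk : 2 ≤ k) (hl : 2 ≤ l) (hn : k + l = n) (t : ℕ) :
    ∃ s, (twoCycle n k)^[s] ∘ (twoCycle n k)^[t] = id ∧
      (twoCycle n k)^[t] ∘ (twoCycle n k)^[s] = id := by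
  have h1 : 1 ≤ k * l := Nat.mul_pos (by omega) (by omega)
  have h : k * l * t = t + (k * l * t - t) := by
    have : t ≤ k * l * t := Nat.le_mul_of_pos_left t h1
    omega
  refine ⟨k * l * t - t, ?_, ?_⟩
  · rw [← Function.iterate_add, add_comm, ← h]; exact iter_period n k l hk hl hn t
  · rw [← Function.iterate_add, ← h]; exact iter_period n k l hk hl hn t

theorem iter_bij (n k l : ℕ) (hk : 2 ≤ k) (hl : 2 ≤ l) (hn : k + l = n) (t : ℕ) :
    Function.Bijective ((twoCycle n k)^[t]) := by
  obtain ⟨s, h1, h2⟩ := iter_inv n k l hk hl hn t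
  exact ⟨Function.LeftInverse.injective (g := (twoCycle n k)^[s]) (fun x => congrFun h1 x),
    Function.RightInverse.surjective (g := (twoCycle n k)^[s]) (fun x => congrFun h2 x)⟩

theorem iter_lt (n k l : ℕ) (hk : 2 ≤ k) (hl : 2 ≤ l) (hn : k + l = n) (t : ℕ) (x : Fin n) :
    (((twoCycle n k)^[t]) x).val < k ↔ x.val < k := by
  rw [iter_val n k l hk hl hn]
  have h1 := Nat.mod_lt (x.val + t) (show 0 < k by omega)
  split_ifs <;> omega

/-- independent rotations -/
theorem exists_rot (n k l : ℕ) (hk : 2 ≤ k) (hl : 2 ≤ l) (hn : k + l = n)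
    (hco : Nat.Coprime k l) (a b : ℕ) :
    ∃ t, ∀ x : Fin n, (((twoCycle n k)^[t]) x).val =
      if x.val < k then (x.val + a) % k else k + (x.val - k + b) % l := by
  obtain ⟨t, h1, h2⟩ := Nat.chineseRemainder hco a b
  refine ⟨t, fun x => ?_⟩
  rw [iter_val n k l hk hl hn]
  split_ifs
  · exact Nat.ModEq.add_left _ h1
  · congr 1
    exact Nat.ModEq.add_left _ h2

/-- The second condition in the definition of `Ukl`. -/
def Cond (n k : ℕ) (γ : Fin n → Fin n) : Prop :=
  (∃ i j : Fin n, i.val < k ∧ k ≤ j.val ∧ γ i = γ j) ∧ ∃ m : Fin n, k ≤ m.val ∧ m ∉ Set.range γ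

theorem mem_Ukl (n k l : ℕ) (hk : 2 ≤ k) (hl : 2 ≤ l) (hn : k + l = n) (γ : Fin n → Fin n) :
    γ ∈ Ukl n k ↔ (∃ t, γ = (twoCycle n k)^[t]) ∨ Cond n k γ := by
  have key : ∀ t, ¬ Cond n k ((twoCycle n k)^[t]) := by
    rintro t ⟨-, m, -, hm⟩
    exact hm ((iter_bij n k l hk hl hn t).2 m)
  constructor
  · rintro (⟨⟨t, -, h⟩, -⟩ | ⟨h, -⟩)
    · exact Or.inl ⟨t, h⟩
    · exact Or.inr h
  · rintro (⟨t, rfl⟩ | h)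
    · refine Or.inl ⟨⟨t + k * l * 1, ?_, ?_⟩, key t⟩
      · have : 1 ≤ k * l := Nat.mul_pos (by omega) (by omega)
        omega
      · rw [Function.iterate_add, iter_period n k l hk hl hn]; rfl
    · refine Or.inr ⟨h, ?_⟩
      rintro ⟨t, -, rfl⟩
      exact key t h

theorem Ukl_comp (n k l : ℕ) (hk : 2 ≤ k) (hl : 2 ≤ l) (hn : k + l = n)
    (f g : Fin n → Fin n) (hf : f ∈ Ukl n k) (hg : g ∈ Ukl n k) : g ∘ f ∈ Ukl n k := by
  rw [mem_Ukl n k l hk hl hn] at *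
  rcases hf with ⟨t, rfl⟩ | ⟨⟨i, j, hi, hj, hij⟩, m, hm, hmf⟩
  · rcases hg with ⟨s, rfl⟩ | ⟨⟨i, j, hi, hj, hij⟩, m, hm, hmf⟩
    · exact Or.inl ⟨s + t, (Function.iterate_add _ _ _).symm⟩
    · right
      obtain ⟨i', rfl⟩ := (iter_bij n k l hk hl hn t).2 i
      obtain ⟨j', rfl⟩ := (iter_bij n k l hk hl hn t).2 j
      have hj' := iter_lt n k l hk hl hn t j'
      refine ⟨⟨i', j', (iter_lt n k l hk hl hn t i').1 hi, by omega, hij⟩, m, hm, ?_⟩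
      rintro ⟨x, hx⟩
      exact hmf ⟨_, hx⟩
  · right
    refine ⟨⟨i, j, hi, hj, congrArg g hij⟩, ?_⟩
    rcases hg with ⟨s, rfl⟩ | ⟨-, m, hm, hmf⟩
    · refine ⟨((twoCycle n k)^[s]) m, ?_, ?_⟩
      · have := iter_lt n k l hk hl hn s m
        omega
      · rintro ⟨x, hx⟩
        exact hmf ⟨x, (iter_bij n k l hk hl hn s).1 hx⟩
    · refine ⟨m, hm, ?_⟩
      rintro ⟨x, hx⟩
      exact hmf ⟨_, hx⟩

theorem beta_val (n : ℕ) (hn : 2 ≤ n) (f : Fin (n - 1) → Fin (n - 1)) (x : Fin n) :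
    (betaOf n f x).val =
      (f ⟨if x.val < n - 1 then x.val else 0, by split_ifs <;> omega⟩).val := by
  unfold betaOf
  split_ifs with h1 h2
  · rfl
  · rfl
  · omega

theorem beta_lt (n : ℕ) (hn : 2 ≤ n) (f : Fin (n - 1) → Fin (n - 1)) (x : Fin n) :
    (betaOf n f x).val < n - 1 := by
  rw [beta_val n hn]; exact Fin.isLt _

theorem beta_comp (n : ℕ) (hn : 2 ≤ n) (f g : Fin (n - 1) → Fin (n - 1)) :
    betaOf n f ∘ betaOf n g = betaOf n (f ∘ g) := by
  funext x
  apply Fin.ext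
  have h := beta_lt n hn g x
  simp only [Function.comp]
  rw [beta_val n hn f, beta_val n hn (f ∘ g)]
  simp only [if_pos h, Function.comp]
  congr 2
  apply Fin.ext
  exact beta_val n hn g x

theorem beta_Cond (n k l : ℕ) (hk : 2 ≤ k) (hl : 2 ≤ l) (hn : k + l = n)
    (f : Fin (n - 1) → Fin (n - 1)) : Cond n k (betaOf n f) := by
  refine ⟨⟨⟨0, by omega⟩, ⟨n - 1, by omega⟩, by simp; omega, by simp; omega, ?_⟩,
    ⟨n - 1, by omega⟩, by simp; omega, ?_⟩
  · apply Fin.ext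
    rw [beta_val n (by omega), beta_val n (by omega)]
    simp
  · rintro ⟨x, hx⟩
    have := beta_lt n (by omega) f x
    rw [hx] at this
    simp at this

/-- Every map satisfying the normalised form is of the form `betaOf`. -/
theorem exists_beta (n : ℕ) (hn : 2 ≤ n) (δ : Fin n → Fin n)
    (h1 : δ ⟨0, by omega⟩ = δ ⟨n - 1, by omega⟩)
    (h2 : ∀ x, δ x ≠ ⟨n - 1, by omega⟩) : ∃ f, δ = betaOf n f := by
  have h3 : ∀ x, (δ x).val < n - 1 := by
    intro x
    have := (δ x).isLt
    have h := h2 x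
    rw [Ne, Fin.ext_iff] at h
    simp only at h
    omega
  refine ⟨fun y => ⟨(δ ⟨y.val, by omega⟩).val, h3 _⟩, ?_⟩
  funext x
  apply Fin.ext
  rw [beta_val n hn]
  by_cases hx : x.val < n - 1
  · simp [hx]
  · have : x = ⟨n - 1, by omega⟩ := by
      apply Fin.ext
      simp only
      have := x.isLt
      omega
    simp only [if_neg hx]
    rw [h1, this]

/-- The full transformation monoid is generated by bijections and one map of corank one. -/
theorem full_gen {T : Type*} [Fintype T] [DecidableEq T] (M : Set (T → T))
    (hM : ∀ f ∈ M, ∀ g ∈ M, f ∘ g ∈ M) (hb : ∀ f, Function.Bijective f → f ∈ M)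
    (e : T → T) (he : e ∈ M) (a b : T) (hab : a ≠ b) (heab : e a = e b)
    (hinj : ∀ x y, x ≠ b → y ≠ b → e x = e y → x = y) : ∀ f, f ∈ M := by
  -- one collapsing map
  have h1 : Function.update id b a ∈ M := by
    have hns : ¬ Function.Surjective e := by
      intro hs
      exact hab ((Finite.injective_iff_surjective.2 hs) heab)
    obtain ⟨c, hc⟩ := not_forall.1 hns
    have hc' : ∀ x, e x ≠ c := fun x hx => hc ⟨x, hx⟩
    have hg : Function.Bijective (Function.update e b c) := by
      rw [← Finite.injective_iff_bijective]
      intro x y hxy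
      by_cases hx : x = b <;> by_cases hy : y = b
      · rw [hx, hy]
      · subst hx; simp [Function.update_of_ne hy] at hxy; exact absurd hxy.symm (hc' y)
      · subst hy; simp [Function.update_of_ne hx] at hxy; exact absurd hxy (hc' x)
      · simp [Function.update_of_ne hx, Function.update_of_ne hy] at hxy
        exact hinj x y hx hy hxy
    let σ := Equiv.ofBijective _ hg
    have : Function.update id b a = σ.symm ∘ e := by
      funext x
      simp only [Function.comp]
      rw [Equiv.eq_symm_apply]
      change Function.update e b c _ = _
      by_cases hx : x = b
      · subst hx; simp [Function.update_of_ne hab, heab]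
      · simp [Function.update_of_ne hx]
    rw [this]
    exact hM _ (hb _ σ.symm.bijective) _ he
  -- all collapsing maps
  have h2 : ∀ a' b' : T, a' ≠ b' → Function.update id b' a' ∈ M := by
    intro a' b' hab'
    obtain ⟨σ, hσa, hσb⟩ : ∃ σ : Equiv.Perm T, σ a = a' ∧ σ b = b' := by
      refine ⟨(Equiv.swap a a').trans (Equiv.swap (Equiv.swap a a' b) b'), ?_, ?_⟩
      · simp only [Equiv.trans_apply, Equiv.swap_apply_left]
        apply Equiv.swap_apply_of_ne_of_ne _ hab'
        intro h
        apply hab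
        apply (Equiv.swap a a').injective
        rw [← h, Equiv.swap_apply_left]
      · simp
    have : Function.update id b' a' = σ ∘ (Function.update id b a ∘ σ.symm) := by
      funext x
      obtain ⟨y, rfl⟩ := σ.surjective x
      simp only [Function.comp, Equiv.symm_apply_apply]
      by_cases hy : y = b
      · subst hy; rw [hσb]; simp [hσa]
      · have : σ y ≠ b' := by rw [← hσb]; exact fun h => hy (σ.injective h)
        simp [Function.update_of_ne hy, Function.update_of_ne this]
    rw [this]
    exact hM _ (hb _ σ.bijective) _ (hM _ h1 _ (hb _ σ.symm.bijective))
  suffices H : ∀ (d : ℕ) (f : T → T), Fintype.card T - (Finset.univ.image f).card = d → f ∈ M from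
    fun f => H _ f rfl
  intro d
  induction d using Nat.strong_induction_on with
  | _ d ih =>
    intro f hd
    by_cases hf : Function.Bijective f
    · exact hb f hf
    have hni : ¬ Function.Injective f := fun h => hf (Finite.injective_iff_bijective.1 h)
    have hns : ¬ Function.Surjective f := fun h => hf (Finite.surjective_iff_bijective.1 h)
    obtain ⟨c, hc⟩ := not_forall.1 hns
    have hc' : ∀ x, f x ≠ c := fun x hx => hc ⟨x, hx⟩
    obtain ⟨p, q, hpq, hne⟩ : ∃ p q, f p = f q ∧ p ≠ q := by
      by_contra hcon
      push Not at hcon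
      exact hni (fun x y h => hcon x y h)
    have hfe : f = Function.update f q c ∘ Function.update id q p := by
      funext x
      simp only [Function.comp]
      by_cases hx : x = q
      · subst hx; simp [Function.update_of_ne hne, hpq]
      · simp [Function.update_of_ne hx]
    have hsub : insert c (Finset.univ.image f) ⊆ Finset.univ.image (Function.update f q c) := by
      intro y hy
      rw [Finset.mem_insert] at hy
      rcases hy with rfl | hy
      · exact Finset.mem_image.2 ⟨q, Finset.mem_univ _, by simp⟩
      · obtain ⟨x, -, rfl⟩ := Finset.mem_image.1 hy
        by_cases hx : x = q
        · subst hx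
          exact Finset.mem_image.2 ⟨p, Finset.mem_univ _, by simp [Function.update_of_ne hne, hpq]⟩
        · exact Finset.mem_image.2 ⟨x, Finset.mem_univ _, by simp [Function.update_of_ne hx]⟩
    have hcard := Finset.card_le_card hsub
    rw [Finset.card_insert_of_notMem (by simpa using hc')] at hcard
    have hle : (Finset.univ.image (Function.update f q c)).card ≤ Fintype.card T :=
      Finset.card_le_univ _
    have hmem := ih _ (by omega) (Function.update f q c) rfl
    rw [hfe]
    exact hM _ hmem _ (h2 p q hne)

/-- **Lemma 3.5 (Holzer–König).** For coprime `k, l ≥ 2` with `k + l = n`, with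
`α = (1 ⋯ k)(k+1 ⋯ n)` and `β` built from any `π₂` such that `{(1 ⋯ k), π₂}`
generates `S_{n-1}`, the set `U_{k,l}` is a submonoid of `T_n` and is generated
by `{α, β}`. -/
theorem lemma_3_5 (n k l : ℕ) (hk : 2 ≤ k) (hl : 2 ≤ l)
    (hco : Nat.Coprime k l) (hn : k + l = n)
    (pi2 : Fin (n - 1) → Fin (n - 1)) (hpi2 : Function.Bijective pi2)
    (hgen : MGen {kCycle (n - 1) k, pi2}
      = {f : Fin (n - 1) → Fin (n - 1) | Function.Bijective f}) :
    (id ∈ Ukl n k ∧ ∀ f ∈ Ukl n k, ∀ g ∈ Ukl n k, g ∘ f ∈ Ukl n k) ∧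
      MGen {twoCycle n k, betaOf n pi2} = Ukl n k := by
  have hn2 : 2 ≤ n := by omega
  have hid : id ∈ Ukl n k := (mem_Ukl n k l hk hl hn id).2 (Or.inl ⟨0, rfl⟩)
  have hcomp := Ukl_comp n k l hk hl hn
  refine ⟨⟨hid, fun f hf g hg => hcomp f g hf hg⟩, ?_⟩
  apply Set.Subset.antisymm
  · intro f hf
    refine MGen_induct (P := fun f => f ∈ Ukl n k) hid ?_ f hf
    intro a ha g hg
    refine hcomp g a hg ?_
    rw [mem_Ukl n k l hk hl hn]
    rcases ha with rfl | ha
    · exact Or.inl ⟨1, rfl⟩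
    · rw [Set.mem_singleton_iff] at ha
      subst ha
      exact Or.inr (beta_Cond n k l hk hl hn pi2)
  · set G := MGen {twoCycle n k, betaOf n pi2} with hG
    have hα : ∀ t, (twoCycle n k)^[t] ∈ G := fun t => MGen_iter (by simp) t
    have hβ : betaOf n pi2 ∈ G := MGen_of (by simp)
    -- lifting words
    have hw : ∀ w ∈ MGen {kCycle (n - 1) k, pi2}, betaOf n (w ∘ pi2) ∈ G := by
      refine MGen_induct hβ ?_
      intro a ha g hg
      rcases ha with rfl | ha
      · obtain ⟨t, ht⟩ := exists_rot n k l hk hl hn hco 1 0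
        have : betaOf n ((kCycle (n - 1) k ∘ g) ∘ pi2) =
            (twoCycle n k)^[t] ∘ betaOf n (g ∘ pi2) := by
          funext x
          apply Fin.ext
          simp only [Function.comp_apply]
          rw [ht, beta_val n hn2, beta_val n hn2]
          simp only [Function.comp_apply, kCycle]
          generalize g _ = y
          have hy := y.isLt
          rw [add_zero]
          have h3 := succ_mod_aux y.val k (by omega)
          by_cases hyk : y.val < k
          · rw [Nat.mod_eq_of_lt hyk] at h3
            rw [if_pos hyk, h3]
            split_ifs <;> first | omega | (rw [Nat.mod_eq_of_lt (by omega)])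
          · rw [if_neg hyk, Nat.mod_eq_of_lt (show y.val - k < l by omega)]
            split_ifs <;> first | omega | (rw [Nat.mod_eq_of_lt (by omega)]; omega)
        rw [this]
        exact MGen_comp (hα t) hg
      · rw [Set.mem_singleton_iff] at ha
        subst ha
        rw [Function.comp_assoc, ← beta_comp n hn2]
        exact MGen_comp hβ hg
    have hbij : ∀ f : Fin (n - 1) → Fin (n - 1), Function.Bijective f → betaOf n f ∈ G := by
      intro f hf
      let σ := Equiv.ofBijective pi2 hpi2
      have h := hw (f ∘ σ.symm) (by
        rw [hgen]; exact hf.comp σ.symm.bijective)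
      have h2 : (f ∘ σ.symm) ∘ pi2 = f := by
        funext x
        exact congrArg f (σ.symm_apply_apply x)
      rwa [h2] at h
    have hall : ∀ f : Fin (n - 1) → Fin (n - 1), betaOf n f ∈ G := by
      obtain ⟨t, ht⟩ := exists_rot n k l hk hl hn hco 0 1
      have hidG : betaOf n id ∈ G := hbij id Function.bijective_id
      let δ := betaOf n id ∘ ((twoCycle n k)^[t] ∘ betaOf n id)
      have hδ : δ ∈ G := MGen_comp hidG (MGen_comp (hα t) hidG)
      let e : Fin (n - 1) → Fin (n - 1) := fun x =>
        ⟨if x.val < k then x.val else if x.val = n - 2 then 0 else x.val + 1, by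
          have := x.isLt
          split_ifs <;> omega⟩
      have hδe : δ = betaOf n e := by
        funext x
        apply Fin.ext
        simp only [δ, Function.comp_apply]
        rw [beta_val n hn2, beta_val n hn2]
        simp only [id, e]
        rw [ht, beta_val n hn2]
        simp only [id]
        have hy : (if x.val < n - 1 then x.val else 0) < n - 1 := by split_ifs <;> omega
        generalize (if x.val < n - 1 then x.val else 0) = y at hy
        rw [add_zero]
        by_cases hyk : y < k
        · simp only [if_pos hyk, Nat.mod_eq_of_lt hyk]
          rw [if_pos hy]
        · simp only [if_neg hyk]
          rw [Nat.mod_eq_of_lt (show y - k + 1 < l by omega)]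
          split_ifs <;> omega
      refine full_gen {f | betaOf n f ∈ G} ?_ hbij e ?_ ⟨0, by omega⟩ ⟨n - 2, by omega⟩ ?_ ?_ ?_
      · intro f hf g hg
        change betaOf n (f ∘ g) ∈ G
        rw [← beta_comp n hn2]
        exact MGen_comp hf hg
      · change betaOf n e ∈ G
        rw [← hδe]; exact hδ
      · intro h
        rw [Fin.ext_iff] at h
        simp only at h
        omega
      · apply Fin.ext
        simp only [e]
        split_ifs <;> omega
      · intro x y hx hy hxy
        rw [Ne, Fin.ext_iff] at hx hy
        rw [Fin.ext_iff] at hxy ⊢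
        simp only [e] at hx hy hxy
        split_ifs at hxy <;> omega
    intro γ hγ
    rw [mem_Ukl n k l hk hl hn] at hγ
    rcases hγ with ⟨t, rfl⟩ | ⟨⟨i, j, hi, hj, hij⟩, m, hm, hmγ⟩
    · exact hα t
    have hjn := j.isLt
    have hmn := m.isLt
    obtain ⟨t, ht⟩ := exists_rot n k l hk hl hn hco i.val (j.val - k + 1)
    obtain ⟨s, hs⟩ := exists_rot n k l hk hl hn hco 0 (n - 1 - m.val)
    have ht0 : (twoCycle n k)^[t] ⟨0, by omega⟩ = i := by
      apply Fin.ext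
      rw [ht]
      simp only
      rw [if_pos (by omega), Nat.zero_add, Nat.mod_eq_of_lt hi]
    have htn : (twoCycle n k)^[t] ⟨n - 1, by omega⟩ = j := by
      apply Fin.ext
      rw [ht]
      simp only
      rw [if_neg (by omega), show n - 1 - k + (j.val - k + 1) = (j.val - k) + l by omega,
        Nat.add_mod_right, Nat.mod_eq_of_lt (by omega)]
      omega
    have hsm : (twoCycle n k)^[s] m = ⟨n - 1, by omega⟩ := by
      apply Fin.ext
      rw [hs]
      simp only
      rw [if_neg (by omega), Nat.mod_eq_of_lt (by omega)]
      omega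
    obtain ⟨f, hf⟩ := exists_beta n hn2 ((twoCycle n k)^[s] ∘ (γ ∘ (twoCycle n k)^[t]))
      (by simp only [Function.comp_apply, ht0, htn, hij])
      (by
        intro x hx
        rw [← hsm] at hx
        exact hmγ ⟨_, (iter_bij n k l hk hl hn s).1 hx⟩)
    obtain ⟨s', hs', -⟩ := iter_inv n k l hk hl hn s
    obtain ⟨t', -, ht'⟩ := iter_inv n k l hk hl hn t
    have hfin : γ = (twoCycle n k)^[s'] ∘ (betaOf n f ∘ (twoCycle n k)^[t']) := by
      rw [← hf]
      funext x
      have h1 := congrFun ht' x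
      have h2 := congrFun hs' (γ x)
      simp only [Function.comp_apply, id] at h1 h2 ⊢
      rw [h1, h2]
    rw [hfin]
    exact MGen_comp (hα s') (MGen_comp (hall f) (hα t'))
end

section
/- For every integer n ≥ 7, there exist coprime integers k, l ≥ 2 with n = k + l such that |U_{k,l}| ≥ n^n · (1 − √2·(2/e)^{n/2}·e^{1/12} − √8·e^{1/12}/√n). -/
lemma sum_img (n j : ℕ) (hj : 2 * j ≤ n + 2) :
    ∑ a : Fin j → Fin n, ((2:ℝ)/3) ^ (Finset.image a Finset.univ).card ≤ (n * (5/6)) ^ j := by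
  induction j with
  | zero => simp
  | succ j ih =>
    have key : ∀ a : Fin j → Fin n, ∑ x : Fin n,
        ((2:ℝ)/3) ^ (Finset.image (Fin.cons x a : Fin (j+1) → Fin n) Finset.univ).card
        ≤ ((2:ℝ)/3) ^ (Finset.image a Finset.univ).card * (n * (5/6)) := by
      intro a
      set S := Finset.image a Finset.univ with hS
      have himg : ∀ x, Finset.image (Fin.cons x a : Fin (j+1) → Fin n) Finset.univ = insert x S := by
        intro x
        ext y
        simp [hS, Fin.exists_fin_succ, eq_comm]
      have hc : S.card ≤ j := by
        simpa using Finset.card_image_le (s := (Finset.univ : Finset (Fin j))) (f := a)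
      have hterm : ∀ x : Fin n, ((2:ℝ)/3) ^ (insert x S).card =
          ((2:ℝ)/3) ^ S.card * (2/3) + (if x ∈ S then ((2:ℝ)/3) ^ S.card * (1/3) else 0) := by
        intro x
        split_ifs with h
        · rw [Finset.insert_eq_of_mem h]; ring
        · rw [Finset.card_insert_of_notMem h, pow_succ]; ring
      simp_rw [himg, hterm]
      rw [Finset.sum_add_distrib, Finset.sum_ite_mem]
      simp only [Finset.sum_const, Finset.card_univ, Fintype.card_fin, Finset.univ_inter, nsmul_eq_mul]
      have h2 : (2:ℝ) * S.card ≤ n := by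
        have : 2 * S.card ≤ n := by omega
        exact_mod_cast this
      have hp : 0 < ((2:ℝ)/3) ^ S.card := by positivity
      nlinarith
    rw [← (Fin.consEquiv (fun _ : Fin (j+1) => Fin n)).sum_comp, Fintype.sum_prod_type, Finset.sum_comm]
    calc _ ≤ ∑ a : Fin j → Fin n, ((2:ℝ)/3) ^ (Finset.image a Finset.univ).card * (n * (5/6)) :=
          Finset.sum_le_sum (fun a _ => key a)
      _ = (∑ a : Fin j → Fin n, ((2:ℝ)/3) ^ (Finset.image a Finset.univ).card) * (n * (5/6)) := by
          rw [Finset.sum_mul]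
      _ ≤ _ := by
          rw [pow_succ]
          exact mul_le_mul_of_nonneg_right (ih (by omega)) (by positivity)

lemma pow_bd (n l i : ℕ) (hn : 0 < n) (hi : i ≤ n) (hl : n ≤ 2 * l) :
    (((n - i : ℕ) : ℝ)) ^ l ≤ n ^ l * (2/3) ^ i := by
  have hn' : (0:ℝ) < n := by exact_mod_cast hn
  have hi' : (i:ℝ) ≤ n := by exact_mod_cast hi
  have hl' : (n:ℝ) ≤ 2 * l := by exact_mod_cast hl
  have e : (((n - i : ℕ) : ℝ)) = n * (1 - i / n) := by
    push_cast [hi]; field_simp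
  rw [e, mul_pow]
  gcongr
  have h0 : 0 ≤ 1 - (i:ℝ)/n := by
    rw [sub_nonneg, div_le_one hn']; exact hi'
  have h1 : 1 - (i:ℝ)/n ≤ Real.exp (-(i/n)) := by
    have := Real.add_one_le_exp (-((i:ℝ)/n)); linarith
  have h2 : Real.exp (-(1/2)) ≤ 2/3 := by
    rw [Real.exp_neg]
    have := Real.add_one_le_exp (1/2 : ℝ)
    rw [inv_le_comm₀ (by positivity) (by positivity)]
    linarith
  calc (1 - (i:ℝ)/n)^l ≤ (Real.exp (-(i/n)))^l := by gcongr
    _ = Real.exp (-(l * (i / n))) := by rw [← Real.exp_nat_mul]; ring_nf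
    _ ≤ Real.exp (i * (-(1/2))) := by
        apply Real.exp_le_exp.2
        have : (1/2:ℝ) ≤ l / n := by rw [le_div_iff₀ hn']; linarith
        have hi0 : (0:ℝ) ≤ i := by positivity
        have : (l:ℝ) * (i / n) = i * (l / n) := by ring
        nlinarith
    _ = (Real.exp (-(1/2)))^i := by rw [Real.exp_nat_mul]
    _ ≤ _ := by gcongr

open Classical in
lemma N1 (k l : ℕ) (hk : 0 < k) (hl : k ≤ l) :
    ((Finset.univ.filter (fun γ : Fin (k+l) → Fin (k+l) =>
      ∀ i j : Fin (k+l), i.val < k → k ≤ j.val → γ i ≠ γ j)).card : ℝ)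
      ≤ ((k+l : ℕ) : ℝ)^(k+l) * (5/6)^k := by
  set n := k + l with hn
  let F : (Fin (k+l) → Fin n) → (Fin k → Fin n) × (Fin l → Fin n) :=
    fun γ => (fun i => γ (Fin.castAdd l i), fun j => γ (Fin.natAdd k j))
  have hF : Function.Injective F := by
    intro γ γ' h
    simp only [F, Prod.mk.injEq] at h
    funext x
    refine Fin.addCases (fun i => congrFun h.1 i) (fun j => congrFun h.2 j) x
  let T : Finset (Σ _ : (Fin k → Fin n), (Fin l → Fin n)) := Finset.univ.sigma
    (fun a => Fintype.piFinset (fun _ : Fin l => (Finset.image a Finset.univ)ᶜ))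
  have h1 : (Finset.univ.filter (fun γ : Fin (k+l) → Fin (k+l) =>
      ∀ i j : Fin (k+l), i.val < k → k ≤ j.val → γ i ≠ γ j)).card ≤ T.card := by
    apply Finset.card_le_card_of_injOn (fun γ => ⟨(F γ).1, (F γ).2⟩)
    · intro γ hγ
      simp only [Finset.coe_filter, Finset.mem_univ, true_and, Set.mem_ofPred_eq] at hγ
      simp only [T, F, Finset.coe_sigma, Set.mem_sigma_iff, Finset.coe_univ, Set.mem_univ, true_and,
        Finset.mem_coe, Fintype.mem_piFinset, Finset.mem_compl, Finset.mem_image, not_exists]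
      rintro j i ⟨_, h⟩
      exact hγ (Fin.castAdd l i) (Fin.natAdd k j) (by simp) (by simp) h
    · intro γ _ γ' _ h
      apply hF
      simp only [Sigma.mk.injEq, heq_eq_eq] at h
      exact Prod.ext h.1 h.2
  have h2 : (T.card : ℝ) = ∑ a : Fin k → Fin n, (((n - (Finset.image a Finset.univ).card : ℕ) : ℝ))^l := by
    simp only [T, Finset.card_sigma, Fintype.card_piFinset, Finset.card_compl, Finset.prod_const,
      Fintype.card_fin, Finset.card_univ]
    push_cast
    rfl
  calc _ ≤ (T.card : ℝ) := by exact_mod_cast h1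
    _ ≤ ∑ a : Fin k → Fin n, (n:ℝ)^l * (2/3) ^ (Finset.image a Finset.univ).card := by
        rw [h2]
        apply Finset.sum_le_sum
        intro a _
        apply pow_bd _ _ _ (by omega) _ (by omega)
        simpa using Finset.card_le_univ (Finset.image a Finset.univ)
    _ ≤ (n:ℝ)^l * (n * (5/6)) ^ k := by
        rw [← Finset.mul_sum]
        gcongr
        exact sum_img n k (by omega)
    _ = _ := by rw [mul_pow, hn, pow_add]; ring

open Classical in
lemma N2 (k l : ℕ) :
    ((Finset.univ.filter (fun γ : Fin (k+l) → Fin (k+l) =>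
      ∀ m : Fin (k+l), k ≤ m.val → m ∈ Set.range γ)).card)
      ≤ (k+l).descFactorial l * (k+l)^k := by
  let t : (Fin l ↪ Fin (k+l)) → Fin (k+l) → Finset (Fin (k+l)) := fun s x =>
    Finset.univ.filter (fun y => ∀ b, s b = x → y = Fin.natAdd k b)
  have hsub : (Finset.univ.filter (fun γ : Fin (k+l) → Fin (k+l) =>
      ∀ m : Fin (k+l), k ≤ m.val → m ∈ Set.range γ)) ⊆
      (Finset.univ : Finset (Fin l ↪ Fin (k+l))).biUnion (fun s => Fintype.piFinset (t s)) := by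
    intro γ hγ
    simp only [Finset.mem_filter, Finset.mem_univ, true_and] at hγ
    have : ∀ b : Fin l, ∃ x, γ x = Fin.natAdd k b := fun b => hγ _ (by simp)
    choose s hs using this
    have hinj : Function.Injective s := by
      intro b b' h
      have := (hs b).symm.trans ((congrArg γ h).trans (hs b'))
      simpa using this
    simp only [Finset.mem_biUnion, Finset.mem_univ, true_and, Fintype.mem_piFinset]
    refine ⟨⟨s, hinj⟩, ?_⟩
    intro x
    simp only [t, Finset.mem_filter, Finset.mem_univ, true_and, Function.Embedding.coeFn_mk]
    rintro b rfl
    exact hs b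
  refine (Finset.card_le_card hsub).trans (Finset.card_biUnion_le.trans ?_)
  have hcard : ∀ s : Fin l ↪ Fin (k+l), (Fintype.piFinset (t s)).card ≤ (k+l)^k := by
    intro s
    rw [Fintype.card_piFinset]
    calc ∏ x, (t s x).card ≤ ∏ x, (if x ∈ Finset.univ.map s then 1 else (k+l)) := by
          apply Finset.prod_le_prod' 
          intro x _
          split_ifs with h
          · simp only [Finset.mem_map, Finset.mem_univ, true_and] at h
            obtain ⟨b, hb⟩ := h
            rw [Finset.card_le_one]
            intro y hy z hz
            simp only [t, Finset.mem_filter, Finset.mem_univ, true_and] at hy hz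
            rw [hy b hb, hz b hb]
          · simpa using Finset.card_le_univ (t s x)
      _ = (k+l)^k := by
          rw [Finset.prod_ite]
          simp only [Finset.prod_const_one, one_mul, Finset.prod_const]
          congr 1
          have : (Finset.univ.filter (fun x => x ∉ Finset.univ.map s)) = (Finset.univ.map s)ᶜ := by
            ext; simp
          rw [this, Finset.card_compl, Finset.card_map]
          simp
  calc _ ≤ ∑ _s : Fin l ↪ Fin (k+l), (k+l)^k := Finset.sum_le_sum (fun s _ => hcard s)
    _ = _ := by simp [Fintype.card_embedding_eq]

lemma ratio (p q : ℕ) (hp : 1 ≤ p) :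
    ((p+q).descFactorial q : ℝ) ≤ ((p+q : ℕ) : ℝ)^q *
      (√(((p+q : ℕ) : ℝ)/p) * (((p+q : ℕ) : ℝ)/p)^p * Real.exp (-q)) := by
  have hst : Stirling.stirlingSeq (p+q) ≤ Stirling.stirlingSeq p := by
    have := Stirling.stirlingSeq'_antitone (show p - 1 ≤ p + q - 1 by omega)
    simp only [Function.comp, Nat.succ_eq_add_one] at this
    rwa [show p - 1 + 1 = p by omega, show p + q - 1 + 1 = p + q by omega] at this
  have hD : ((p+q).factorial : ℝ) = p.factorial * (p+q).descFactorial q := by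
    have := Nat.factorial_mul_descFactorial (show q ≤ p + q by omega)
    rw [show p + q - q = p by omega] at this
    exact_mod_cast this.symm
  unfold Stirling.stirlingSeq at hst
  rw [hD] at hst
  set n : ℝ := ((p+q : ℕ) : ℝ) with hn
  have hp0 : (0:ℝ) < p := by exact_mod_cast hp
  have hn0 : (0:ℝ) < n := by rw [hn]; exact_mod_cast (by omega : 0 < p + q)
  have hpf : (0:ℝ) < p.factorial := by exact_mod_cast p.factorial_pos
  rw [div_le_div_iff₀ (by positivity) (by positivity), mul_assoc, mul_le_mul_iff_right₀ hpf] at hst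
  have he : Real.exp (-(q:ℝ)) = (Real.exp 1 ^ q)⁻¹ := by
    rw [Real.exp_neg, ← Real.exp_nat_mul, mul_one]
  rw [← le_div_iff₀ (by positivity)] at hst
  refine hst.trans (le_of_eq ?_)
  rw [he, Real.sqrt_mul (by norm_num), Real.sqrt_mul (by norm_num), Real.sqrt_div hn0.le]
  simp only [div_pow]
  field_simp
  ring

lemma ratio_even (p : ℕ) (hp : 1 ≤ p) (x : ℝ) (hx : x = ((p+p : ℕ) : ℝ) / 2) :
    ((p+p).descFactorial p : ℝ) ≤ ((p+p : ℕ) : ℝ)^p * (√2 * (2 / Real.exp 1) ^ x) := by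
  refine (ratio p p hp).trans (le_of_eq ?_)
  have hp0 : (0:ℝ) < p := by exact_mod_cast hp
  have h2 : (((p+p : ℕ) : ℝ)/p) = 2 := by push_cast; field_simp; norm_num
  have hx : x = p := by rw [hx]; push_cast; ring
  rw [h2, hx, Real.rpow_natCast, div_pow, Real.exp_neg, ← Real.exp_nat_mul, mul_one]
  ring

lemma ratio_odd (p : ℕ) (hp : 1 ≤ p) (x : ℝ) (hx : x = ((p+(p+1) : ℕ) : ℝ) / 2) :
    ((p+(p+1)).descFactorial (p+1) : ℝ) ≤ ((p+(p+1) : ℕ) : ℝ)^(p+1) *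
      (√2 * (2 / Real.exp 1) ^ x) := by
  refine (ratio p (p+1) hp).trans (mul_le_mul_of_nonneg_left ?_ (by positivity))
  have hp1 : (1:ℝ) ≤ p := by exact_mod_cast hp
  have hp0 : (0:ℝ) < p := by linarith
  have h2 : (((p+(p+1) : ℕ) : ℝ)/p) = 2 * (1 / (2 * p) + 1) := by push_cast; field_simp; ring
  have hx : x = p + 1/2 := by rw [hx]; push_cast; ring
  have hs : √(((p+(p+1) : ℕ) : ℝ)/p) ≤ 2 := by
    rw [Real.sqrt_le_left (by norm_num), div_le_iff₀ hp0]
    push_cast; linarith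
  have hpow : (((p+(p+1) : ℕ) : ℝ)/p)^p ≤ 2^p * Real.exp (1/2) := by
    rw [h2, mul_pow]
    gcongr
    calc (1 / (2 * (p:ℝ)) + 1)^p ≤ (Real.exp (1 / (2 * (p:ℝ))))^p := by
          gcongr; exact Real.add_one_le_exp _
      _ = Real.exp (1/2) := by rw [← Real.exp_nat_mul]; congr 1; field_simp
  calc _ ≤ 2 * (2^p * Real.exp (1/2)) * Real.exp (-((p+1 : ℕ) : ℝ)) :=
        mul_le_mul_of_nonneg_right (mul_le_mul hs hpow (by positivity) (by norm_num)) (by positivity)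
    _ = _ := by
      rw [hx, Real.rpow_add (by positivity), Real.rpow_natCast, ← Real.sqrt_eq_rpow,
        Real.sqrt_div (by norm_num), ← Real.exp_half, div_pow, ← Real.exp_nat_mul, mul_one]
      have e1 : Real.exp (-((p+1 : ℕ) : ℝ)) = (Real.exp p)⁻¹ * ((Real.exp (1/2))⁻¹ * (Real.exp (1/2))⁻¹) := by
        rw [← Real.exp_neg, ← Real.exp_neg, ← Real.exp_add, ← Real.exp_add]
        congr 1; push_cast; ring
      have e2 : √2 * √2 = (2:ℝ) := Real.mul_self_sqrt (by norm_num)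
      rw [e1]
      field_simp
      linear_combination (-1) * e2

lemma ratio_all (k l : ℕ) (hk : 1 ≤ k) (hl : k ≤ l) :
    ((k+l).descFactorial l : ℝ) ≤ ((k+l : ℕ) : ℝ)^l *
      (√2 * (2 / Real.exp 1) ^ (((k+l : ℕ) : ℝ) / 2)) := by
  obtain ⟨p, q, hpq, hn, hp⟩ : ∃ p q, (q = p ∨ q = p + 1) ∧ k + l = p + q ∧ 1 ≤ p :=
    ⟨(k+l)/2, (k+l) - (k+l)/2, by omega, by omega, by omega⟩
  have hql : q ≤ l := by omega
  have hb : ((k+l).descFactorial q : ℝ) ≤ ((k+l : ℕ) : ℝ)^q *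
      (√2 * (2 / Real.exp 1) ^ (((k+l : ℕ) : ℝ) / 2)) := by
    rw [hn]
    rcases hpq with rfl | rfl
    · exact ratio_even _ hp _ rfl
    · exact ratio_odd _ hp _ rfl
  have hm := Nat.descFactorial_mul_descFactorial (n := k+l) hql
  have hle : (k + l - q).descFactorial (l - q) ≤ (k+l)^(l-q) :=
    (Nat.descFactorial_le_pow _ _).trans (Nat.pow_le_pow_left (by omega) _)
  have hle' : ((k + l - q).descFactorial (l - q) : ℝ) ≤ ((k+l : ℕ):ℝ)^(l-q) := by exact_mod_cast hle
  rw [← hm, Nat.cast_mul]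
  calc _ ≤ ((k+l : ℕ):ℝ)^(l-q) * (((k+l : ℕ) : ℝ)^q *
      (√2 * (2 / Real.exp 1) ^ (((k+l : ℕ) : ℝ) / 2))) := by gcongr
    _ = _ := by rw [← mul_assoc, ← pow_add, Nat.sub_add_cancel hql]

lemma iter_sep (n k : ℕ) (hk : 1 ≤ k) (hkn : k < n) (m : ℕ) :
    ∀ i : Fin n, (((twoCycle n k)^[m] i).val < k ↔ i.val < k) := by
  induction m with
  | zero => simp
  | succ m ih =>
    intro i
    rw [Function.iterate_succ_apply, ih]
    simp only [twoCycle]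
    have := i.isLt
    split_ifs with h1 h2
    · simp; omega
    · rw [Nat.mod_eq_of_lt hkn]; omega
    · rw [Nat.mod_eq_of_lt (by omega)]; omega

lemma five_six (n k : ℕ) (hn : 1 ≤ n) (hk : n ≤ 2 * k + 4) :
    ((5:ℝ)/6)^k ≤ √8 * Real.exp (1/12) / √n := by
  have hn0 : (1:ℝ) ≤ n := by exact_mod_cast hn
  have hk' : (n:ℝ) ≤ 2 * k + 4 := by exact_mod_cast hk
  have hs : 0 < √(n:ℝ) := Real.sqrt_pos.2 (by linarith)
  have hsq : √(n:ℝ) * √(n:ℝ) = n := Real.mul_self_sqrt (by linarith)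
  have hE : (1:ℝ) ≤ Real.exp (1/12) := Real.one_le_exp (by norm_num)
  have h8 : (5/2:ℝ) ≤ √8 := Real.le_sqrt_of_sq_le (by norm_num)
  have hbern : 1 + (k:ℝ) * (1/5) ≤ (6/5)^k := by
    have := one_add_mul_le_pow (show (-2:ℝ) ≤ 1/5 by norm_num) k
    norm_num at this ⊢
    linarith
  have hinv : ((5:ℝ)/6)^k * (6/5)^k = 1 := by rw [← mul_pow]; norm_num
  have hpos : 0 < ((5:ℝ)/6)^k := by positivity
  have h1 : √(n:ℝ) ≤ 5/2 * (6/5)^k := by nlinarith [sq_nonneg (√(n:ℝ) - 2)]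
  rw [le_div_iff₀ hs]
  calc ((5:ℝ)/6)^k * √(n:ℝ) ≤ ((5:ℝ)/6)^k * (5/2 * (6/5)^k) := by gcongr
    _ = 5/2 * 1 := by linear_combination (5/2) * hinv
    _ ≤ _ := by gcongr

open Classical in
lemma main_bound (k l : ℕ) (hk : 1 ≤ k) (hl : k ≤ l) (hkl : l ≤ k + 4) :
    ((Ukl (k+l) k).ncard : ℝ) ≥ ((k+l : ℕ) : ℝ) ^ (k+l) *
        (1 - Real.sqrt 2 * (2 / Real.exp 1) ^ (((k+l : ℕ) : ℝ) / 2) * Real.exp (1 / 12)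
          - Real.sqrt 8 * Real.exp (1 / 12) / Real.sqrt ((k+l : ℕ) : ℝ)) := by
  set A := (Finset.univ.filter (fun γ : Fin (k+l) → Fin (k+l) =>
      ∀ i j : Fin (k+l), i.val < k → k ≤ j.val → γ i ≠ γ j)) with hA
  set B := (Finset.univ.filter (fun γ : Fin (k+l) → Fin (k+l) =>
      ∀ m : Fin (k+l), k ≤ m.val → m ∈ Set.range γ)) with hB
  have hsub : (((A ∪ B)ᶜ : Finset _) : Set (Fin (k+l) → Fin (k+l))) ⊆ Ukl (k+l) k := by
    intro γ hγ
    simp only [Finset.coe_compl, Set.mem_compl_iff, Finset.mem_coe, Finset.mem_union, hA, hB,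
      Finset.mem_filter, Finset.mem_univ, true_and, not_or] at hγ
    obtain ⟨h1, h2⟩ := hγ
    push Not at h1 h2
    obtain ⟨i, j, hi, hj, hij⟩ := h1
    obtain ⟨m, hm, hm'⟩ := h2
    refine Or.inr ⟨⟨⟨i, j, hi, hj, hij⟩, m, hm, hm'⟩, ?_⟩
    rintro ⟨r, _, rfl⟩
    have a := (iter_sep (k+l) k hk (by omega) r i).2 hi
    rw [hij, iter_sep (k+l) k hk (by omega) r j] at a
    omega
  have h1 : ((A ∪ B)ᶜ).card ≤ (Ukl (k+l) k).ncard := by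
    rw [← Set.ncard_coe_finset]
    exact Set.ncard_le_ncard hsub (Set.toFinite _)
  have h2 : (k+l)^(k+l) ≤ ((A ∪ B)ᶜ).card + (A.card + B.card) := by
    have a := Finset.card_add_card_compl (A ∪ B)
    have b := Finset.card_union_le A B
    simp only [Fintype.card_fun, Fintype.card_fin] at a
    omega
  have h3 : (k+l)^(k+l) ≤ (Ukl (k+l) k).ncard + (A.card + B.card) := by omega
  have h3' : ((k+l : ℕ) : ℝ)^(k+l) ≤ (Ukl (k+l) k).ncard + (A.card + B.card) := by exact_mod_cast h3
  have hN1 := N1 k l hk hl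
  rw [← hA] at hN1
  have hN2 : (B.card : ℝ) ≤ ((k+l).descFactorial l : ℝ) * ((k+l : ℕ) : ℝ)^k := by
    exact_mod_cast N2 k l
  have hr := ratio_all k l hk hl
  have h56 := five_six (k+l) k (by omega) (by omega)
  have hE : (1:ℝ) ≤ Real.exp (1/12) := Real.one_le_exp (by norm_num)
  set n : ℝ := ((k+l : ℕ) : ℝ) with hn
  set X := √2 * (2 / Real.exp 1) ^ (n / 2) with hX
  have hX0 : 0 ≤ X := by positivity
  have hn0 : 0 ≤ n := by positivity
  have hB2 : (B.card : ℝ) ≤ n^(k+l) * (X * Real.exp (1/12)) := by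
    calc (B.card : ℝ) ≤ (n^l * X) * n^k := hN2.trans (by gcongr)
      _ = n^(k+l) * (X * 1) := by rw [pow_add]; ring
      _ ≤ _ := by gcongr
  have hA2 : (A.card : ℝ) ≤ n^(k+l) * (√8 * Real.exp (1/12) / √n) :=
    hN1.trans (by gcongr)
  rw [ge_iff_le, mul_sub, mul_sub, mul_one]
  linarith

/-- **Theorem 3.6 (Holzer–König).** For `n ≥ 7` there are coprime `k, l ≥ 2` with
`k + l = n` and
`|U_{k,l}| ≥ n^n (1 - √2 (2/e)^(n/2) e^(1/12) - √8 e^(1/12) / √n)`. -/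
theorem theorem_3_6 (n : ℕ) (hn : 7 ≤ n) :
    ∃ k l : ℕ, 2 ≤ k ∧ 2 ≤ l ∧ Nat.Coprime k l ∧ k + l = n ∧
      ((Ukl n k).ncard : ℝ) ≥ (n : ℝ) ^ n *
        (1 - Real.sqrt 2 * (2 / Real.exp 1) ^ ((n : ℝ) / 2) * Real.exp (1 / 12)
          - Real.sqrt 8 * Real.exp (1 / 12) / Real.sqrt n) := by
  obtain ⟨k, l, hk, hl, hkl, hc, h⟩ : ∃ k l : ℕ, 2 ≤ k ∧ k ≤ l ∧ l ≤ k + 4 ∧ Nat.Coprime k l ∧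
      k + l = n := by
    obtain ⟨p, hp | hp | hp⟩ : ∃ p, n = 2 * p + 1 ∨ n = 4 * p ∨ n = 4 * p + 2 := by
      by_cases h1 : n % 2 = 1
      · exact ⟨n / 2, by omega⟩
      · exact ⟨n / 4, by omega⟩
    · refine ⟨p, p + 1, by omega, by omega, by omega, ?_, by omega⟩
      simp
    · refine ⟨2 * p - 1, 2 * p - 1 + 2, by omega, by omega, by omega, ?_, by omega⟩
      rw [Nat.coprime_self_add_right, Nat.coprime_two_right]
      exact Nat.odd_iff.2 (by omega)
    · refine ⟨2 * p - 1, 2 * p - 1 + 2 ^ 2, by omega, by omega, by omega, ?_, by omega⟩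
      rw [Nat.coprime_self_add_right]
      apply Nat.Coprime.pow_right
      rw [Nat.coprime_two_right]
      exact Nat.odd_iff.2 (by omega)
  subst h
  exact ⟨k, l, hk, by omega, hc, rfl, main_bound k l (by omega) hl hkl⟩
end

section
/- For every integer n ≥ 7, there exists a regular language L over an alphabet of size 2 with sc(L) ≤ n such that sc(root(L)) ≥ n^n · (1 − √2·(2/e)^{n/2}·e^{1/12} − √8·e^{1/12}/√n) − n(n−1)/2. -/
/-- `root L` = words some positive power of which lies in `L`. -/
def root {A : Type} (L : Language A) : Language A :=
  {w | ∃ m : ℕ, 1 ≤ m ∧ (List.replicate m w).flatten ∈ L}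

/-- A language is regular if some DFA with finitely many states recognizes it. -/
def IsReg {A : Type} (L : Language A) : Prop :=
  ∃ (σ : Type) (_ : Fintype σ) (M : DFA A σ), M.accepts = L

/-- The state complexity of a language: the least number of states of a DFA recognizing it. -/
noncomputable def sc {A : Type} (L : Language A) : ℕ :=
  sInf {m | ∃ (σ : Type) (_ : Fintype σ) (M : DFA A σ), M.accepts = L ∧ Fintype.card σ = m}

set_option linter.unusedSectionVars false
namespace RootSC

open Function

/-- Howie: non-injective maps are generated by the rank `n-1` idempotents `x ↦ y`. -/
theorem perm_comp {T : Type} [Fintype T] [DecidableEq T] (P : (T → T) → Prop)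
    (hc : ∀ f g, P f → P g → P (f ∘ g))
    (he : ∀ x y, x ≠ y → P (update id x y))
    (π : Equiv.Perm T) : ∀ g, P g → (∃ x, ∀ t, g t ≠ x) → P (π ∘ g) := by
  induction π using Equiv.Perm.swap_induction_on with
  | one => intro g hg _; simpa using hg
  | swap_mul σ u v huv ih =>
    intro g hg hx
    have h1 := ih g hg hx
    obtain ⟨x0, hx0⟩ := hx
    -- the new missing point
    obtain ⟨x, hx⟩ : ∃ x, ∀ t, (σ ∘ g) t ≠ x := ⟨σ x0, fun t h => hx0 t (σ.injective h)⟩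
    have key : P (Equiv.swap u v ∘ (σ ∘ g)) := by
      generalize hG : (σ ∘ g : T → T) = G at *
      by_cases hux : x = u
      · subst hux
        have : (Equiv.swap x v ∘ G : T → T) = update id v x ∘ G := by
          funext t
          have := hx t
          simp only [comp_apply, Equiv.swap_apply_def, update_apply, id]
          grind
        rw [this]; exact hc _ _ (he _ _ huv.symm) h1
      · by_cases hvx : x = v
        · subst hvx
          have : (Equiv.swap u x ∘ G : T → T) = update id u x ∘ G := by
            funext t
            have := hx t
            simp only [comp_apply, Equiv.swap_apply_def, update_apply, id]
            grind
          rw [this]; exact hc _ _ (he _ _ huv) h1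
        · have : (Equiv.swap u v ∘ G : T → T) =
              update id x v ∘ (update id v u ∘ (update id u x ∘ G)) := by
            funext t
            have := hx t
            simp only [comp_apply, Equiv.swap_apply_def, update_apply, id]
            grind
          rw [this]
          exact hc _ _ (he _ _ hvx) (hc _ _ (he _ _ (Ne.symm huv)) (hc _ _ (he _ _ (Ne.symm hux)) h1))
    exact key

theorem howie {T : Type} [Fintype T] [DecidableEq T] (P : (T → T) → Prop)
    (hc : ∀ f g, P f → P g → P (f ∘ g))
    (he : ∀ x y, x ≠ y → P (update id x y)) :
    ∀ (N : ℕ) (h : T → T), (Finset.univ \ Finset.univ.image h).card ≤ N → ¬ Injective h → P h := by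
  intro N
  induction N with
  | zero =>
    intro h hN hi
    exfalso
    apply hi
    have : Surjective h := by
      intro y
      have h0 : (Finset.univ \ Finset.univ.image h) = ∅ := by
        apply Finset.card_eq_zero.mp; omega
      by_contra hy
      have : y ∈ (Finset.univ \ Finset.univ.image h) := by
        simp; intro x hx; exact hy ⟨x, hx⟩
      rw [h0] at this; simp at this
    exact (Finite.injective_iff_surjective).mpr this
  | succ N ih =>
    intro h hN hi
    have hns : ¬ Surjective h := fun hs => hi ((Finite.injective_iff_surjective).mpr hs)
    obtain ⟨v, hv⟩ : ∃ v, ∀ t, h t ≠ v := by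
      simpa [Surjective] using hns
    obtain ⟨x, y, hxy, hne⟩ : ∃ x y, h x = h y ∧ x ≠ y := by
      simpa [Injective] using hi
    have hcomp : h = update h x v ∘ update id x y := by
      funext t
      simp only [comp_apply, update_apply, id]
      grind
    by_cases hinj : Injective (update h x v)
    · let π : Equiv.Perm T := Equiv.ofBijective _ (Finite.injective_iff_bijective.mp hinj)
      have : h = π ∘ update id x y := hcomp
      rw [this]
      apply perm_comp P hc he π _ (he x y hne)
      refine ⟨x, fun t => ?_⟩
      simp only [update_apply, id]
      grind
    · rw [hcomp]
      apply hc _ _ _ (he x y hne)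
      apply ih _ _ hinj
      have hlt : (Finset.univ \ Finset.univ.image (update h x v)) ⊂
          (Finset.univ \ Finset.univ.image h) := by
        rw [Finset.ssubset_iff_of_subset]
        · refine ⟨v, ?_, ?_⟩
          · simpa using hv
          · simp only [Finset.mem_sdiff, Finset.mem_univ, true_and, not_not, Finset.mem_image]
            exact ⟨x, by simp⟩
        · intro w hw
          simp only [Finset.mem_sdiff, Finset.mem_univ, true_and, Finset.mem_image, not_exists,
            update_apply] at hw ⊢
          intro t ht
          by_cases htx : t = x
          · subst htx
            have := hw y
            grind
          · have := hw t
            grind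
      have := Finset.card_lt_card hlt
      omega

end RootSC
namespace RootSC

set_option linter.unusedSectionVars false

open Function

abbrev V (k l : ℕ) := ZMod k ⊕ ZMod l

def rot {k l : ℕ} (s : ZMod k) (t : ZMod l) : V k l → V k l := Sum.map (· + s) (· + t)

def z {k l : ℕ} : V k l := Sum.inr 1
def x0 {k l : ℕ} : V k l := Sum.inl 0
def y0 {k l : ℕ} : V k l := Sum.inr 0

def bet {k l : ℕ} (x : V k l) : V k l := if x = x0 then y0 else if x = z then x0 else x

def aut (k l : ℕ) : DFA (Fin 2) (V k l) where
  step q a := if a = 0 then rot 1 1 q else bet q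
  start := x0
  accept := {x0}

def G {k l : ℕ} (f : V k l → V k l) : Prop := ∃ w, ∀ x, (aut k l).evalFrom x w = f x

variable {k l : ℕ}

theorem G_comp {f g : V k l → V k l} (hf : G f) (hg : G g) : G (f ∘ g) := by
  obtain ⟨u, hu⟩ := hf
  obtain ⟨w, hw⟩ := hg
  refine ⟨w ++ u, fun x => ?_⟩
  rw [DFA.evalFrom_of_append, hw, hu]; rfl

theorem G_id : G (id : V k l → V k l) := ⟨[], fun x => rfl⟩
theorem G_bet : G (bet : V k l → V k l) := ⟨[1], fun x => by simp [aut]⟩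
theorem G_rot1 : G (rot 1 1 : V k l → V k l) := ⟨[0], fun x => by simp [aut]⟩

theorem rot_rot (s s' : ZMod k) (t t' : ZMod l) (x : V k l) :
    rot s t (rot s' t' x) = rot (s' + s) (t' + t) x := by
  rcases x with x | x <;> simp [rot, add_assoc]

theorem rot_zero (x : V k l) : rot 0 0 x = x := by
  rcases x with x | x <;> simp [rot]

theorem G_rotn (m : ℕ) : G (rot (m : ZMod k) (m : ZMod l) : V k l → V k l) := by
  induction m with
  | zero =>
    have : (rot ((0:ℕ) : ZMod k) ((0:ℕ) : ZMod l) : V k l → V k l) = id := by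
      funext x; simpa using rot_zero x
    rw [this]; exact G_id
  | succ m ih =>
    have := G_comp G_rot1 ih
    convert this using 1
    funext x; rw [comp_apply, rot_rot]; push_cast; rfl

theorem G_rot [NeZero k] [NeZero l] (hkl : Nat.Coprime k l) (s : ZMod k) (t : ZMod l) :
    G (rot s t : V k l → V k l) := by
  obtain ⟨m, h1, h2⟩ := Nat.chineseRemainder hkl s.val t.val
  have e1 : (m : ZMod k) = s := by
    rw [(ZMod.natCast_eq_natCast_iff _ _ _).mpr h1]; simp
  have e2 : (m : ZMod l) = t := by
    rw [(ZMod.natCast_eq_natCast_iff _ _ _).mpr h2]; simp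
  rw [← e1, ← e2]; exact G_rotn m

/-- Maps admissible to be post-composed to maps missing `z`. -/
def Adm (h : V k l → V k l) : Prop :=
  ∀ g : V k l → V k l, (∀ v, g v ≠ z) → G g → G (h ∘ g) ∧ ∀ v, h (g v) ≠ z

theorem Adm_comp {h h' : V k l → V k l} (a : Adm h) (b : Adm h') : Adm (h ∘ h') := by
  intro g hg Gg
  obtain ⟨b1, b2⟩ := b g hg Gg
  exact a (h' ∘ g) b2 b1

theorem Adm_congr {h h' : V k l → V k l} (a : Adm h) (e : ∀ x, x ≠ z → h x = h' x) : Adm h' := by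
  intro g hg Gg
  have : h' ∘ g = h ∘ g := by funext v; exact (e _ (hg v)).symm
  obtain ⟨b1, b2⟩ := a g hg Gg
  refine ⟨this ▸ b1, fun v => ?_⟩
  rw [← e _ (hg v)]; exact b2 v

theorem Adm_rot [NeZero k] [NeZero l] (hkl : Nat.Coprime k l) (s : ZMod k) :
    Adm (rot s 0 : V k l → V k l) := by
  intro g hg Gg
  refine ⟨G_comp (G_rot hkl s 0) Gg, fun v => ?_⟩
  have := hg v
  rcases h : g v with x | x
  · simp [rot, z]
  · rw [h] at this; simpa [rot, z] using this

def cc (j : ZMod l) (x : V k l) : V k l :=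
  Equiv.swap x0 z (rot 0 j (Equiv.swap x0 z x))

theorem cc_cc (i j : ZMod l) (x : V k l) : cc i (cc j x) = cc (j + i) x := by
  simp [cc, rot_rot]

theorem cc_zero (x : V k l) : cc 0 x = x := by
  simp [cc, rot_zero]

theorem one_ne [Fact (1 < l)] : (1 : ZMod l) ≠ 0 := one_ne_zero

theorem bet_ne_z [Fact (1 < l)] (x : V k l) : bet x ≠ z := by
  unfold bet
  have : (y0 : V k l) ≠ z := by simp [y0, z]
  have : (x0 : V k l) ≠ z := by simp [x0, z]
  grind

theorem Adm_bet [Fact (1 < l)] : Adm (bet : V k l → V k l) := by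
  intro g hg Gg
  exact ⟨G_comp G_bet Gg, fun v => bet_ne_z _⟩

theorem Adm_cc_neg_one [NeZero k] [NeZero l] [Fact (1 < l)] (hkl : Nat.Coprime k l) :
    Adm (cc (-1) : V k l → V k l) := by
  intro g hg Gg
  have key : ∀ x : V k l, x ≠ z → cc (-1) x = bet (rot 0 (-1) x) := by
    intro x hx
    rcases x with x | x
    · by_cases h : x = 0
      · subst h
        have e : (Sum.inl 0 : V k l) = x0 := rfl
        have e2 : (rot 0 (-1) x0 : V k l) = x0 := by simp [rot, x0]
        have e3 : (rot 0 (-1) z : V k l) = y0 := by simp [rot, z, y0]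
        rw [e, e2]
        simp only [cc, Equiv.swap_apply_left, e3, bet, if_true]
        apply Equiv.swap_apply_of_ne_of_ne <;> simp [x0, y0, z]
      · have e1 : Equiv.swap (x0 : V k l) z (Sum.inl x) = Sum.inl x := by
          apply Equiv.swap_apply_of_ne_of_ne <;> simp [x0, z, h]
        have e2 : (rot 0 (-1) (Sum.inl x) : V k l) = Sum.inl x := by simp [rot]
        have e3 : (Sum.inl x : V k l) ≠ x0 := by simp [x0, h]
        simp only [cc, e1, e2, bet, if_neg e3, if_neg hx]
    · have e1 : Equiv.swap (x0 : V k l) z (Sum.inr x) = Sum.inr x := by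
        apply Equiv.swap_apply_of_ne_of_ne _ hx; simp [x0]
      have e2 : (rot 0 (-1) (Sum.inr x) : V k l) = Sum.inr (x - 1) := by simp [rot, sub_eq_add_neg]
      have e3 : (Sum.inr (x - 1) : V k l) ≠ x0 := by simp [x0]
      simp only [cc, e1, e2, bet, Equiv.swap_apply_def, if_neg e3]
  have : cc (-1) ∘ g = bet ∘ (rot 0 (-1) ∘ g) := by funext v; exact key _ (hg v)
  rw [this]
  refine ⟨G_comp G_bet (G_comp (G_rot hkl _ _) Gg), fun v => ?_⟩
  rw [key _ (hg v)]; exact bet_ne_z _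

theorem Adm_cc [NeZero k] [NeZero l] [Fact (1 < l)] (hkl : Nat.Coprime k l) (j : ZMod l) :
    Adm (cc j : V k l → V k l) := by
  have h : ∀ m : ℕ, Adm (cc (-(m : ZMod l)) : V k l → V k l) := by
    intro m
    induction m with
    | zero =>
      intro g hg Gg
      have : cc (-((0:ℕ) : ZMod l)) ∘ g = g := by funext v; simp [cc_zero]
      rw [this]
      exact ⟨Gg, fun v => by simpa [cc_zero] using hg v⟩
    | succ m ih =>
      have := Adm_comp (Adm_cc_neg_one hkl) ih
      refine Adm_congr this fun x _ => ?_
      rw [comp_apply, cc_cc]; congr 1; push_cast; ring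
  have := h (-j).val
  simpa using this

def D (x y : V k l) : Prop := Adm (update id x y : V k l → V k l)

theorem D_conj {σ τ : V k l → V k l} (hσ : Adm σ) (hτ : Adm τ) (h1 : ∀ x, σ (τ x) = x)
    (h2 : ∀ x, τ (σ x) = x) {x y : V k l} (h : D x y) : D (σ x) (σ y) := by
  refine Adm_congr (Adm_comp hσ (Adm_comp h hτ)) fun v _ => ?_
  simp only [comp_apply, update_apply, id]
  by_cases hv : v = σ x
  · subst hv; simp [h2]
  · have : τ v ≠ x := fun e => hv (by rw [← e, h1])
    simp [hv, this, h1]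

variable [NeZero k] [NeZero l] [Fact (1 < k)] [Fact (1 < l)]

theorem D_base : D (x0 : V k l) y0 := by
  refine Adm_congr Adm_bet fun v hv => ?_
  simp [bet, update_apply, hv]

theorem D_rot (hkl : Nat.Coprime k l) (s : ZMod k) {x y : V k l} (h : D x y) :
    D (rot s 0 x) (rot s 0 y) := by
  apply D_conj (Adm_rot hkl s) (Adm_rot hkl (-s)) _ _ h <;> intro x <;> simp [rot_rot, rot_zero]

theorem D_cc (hkl : Nat.Coprime k l) (s : ZMod l) {x y : V k l} (h : D x y) :
    D (cc s x) (cc s y) := by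
  apply D_conj (Adm_cc hkl s) (Adm_cc hkl (-s)) _ _ h <;> intro x <;> simp [cc_cc, cc_zero]

theorem cc_inl {i : ZMod k} (hi : i ≠ 0) (s : ZMod l) : cc s (Sum.inl i : V k l) = Sum.inl i := by
  have e1 : Equiv.swap (x0 : V k l) z (Sum.inl i) = Sum.inl i := by
    apply Equiv.swap_apply_of_ne_of_ne <;> simp [x0, z, hi]
  simp [cc, e1, rot]

theorem cc_inr {j : ZMod l} (hj : j ≠ 1) (s : ZMod l) (hs : j + s ≠ 1) :
    cc s (Sum.inr j : V k l) = Sum.inr (j + s) := by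
  have e1 : ∀ j : ZMod l, j ≠ 1 → Equiv.swap (x0 : V k l) z (Sum.inr j) = Sum.inr j := by
    intro j hj
    apply Equiv.swap_apply_of_ne_of_ne <;> simp [x0, z, hj]
  simp [cc, e1 j hj, rot, e1 _ hs]

theorem cc_inr' {j : ZMod l} (hj : j ≠ 1) (s : ZMod l) (hs : j + s = 1) :
    cc s (Sum.inr j : V k l) = Sum.inl 0 := by
  have e1 : ∀ j : ZMod l, j ≠ 1 → Equiv.swap (x0 : V k l) z (Sum.inr j) = Sum.inr j := by
    intro j hj
    apply Equiv.swap_apply_of_ne_of_ne <;> simp [x0, z, hj]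
  have : (Sum.inr 1 : V k l) = z := rfl
  simp [cc, e1 j hj, rot, hs, this]; rfl

theorem cc_x0 (s : ZMod l) (hs : s ≠ 0) :
    cc s (Sum.inl 0 : V k l) = Sum.inr (1 + s) := by
  have e1 : ∀ j : ZMod l, j ≠ 1 → Equiv.swap (x0 : V k l) z (Sum.inr j) = Sum.inr j := by
    intro j hj
    apply Equiv.swap_apply_of_ne_of_ne <;> simp [x0, z, hj]
  have : (Sum.inl 0 : V k l) = x0 := rfl
  have h2 : rot 0 s (z : V k l) = Sum.inr (1 + s) := by simp [rot, z]
  simp only [cc, this, Equiv.swap_apply_left, h2]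
  exact e1 _ (by simpa using hs)

theorem D_all (hkl : Nat.Coprime k l) (x y : V k l) (hx : x ≠ z) (hy : y ≠ z) (hxy : x ≠ y) :
    D x y := by
  have h1 : ∀ i : ZMod k, D (Sum.inl i : V k l) y0 := by
    intro i
    have := D_rot hkl i (D_base (k := k) (l := l))
    simpa [rot, x0, y0] using this
  -- nonzero `i` to anything in the second cycle
  have h2 : ∀ i : ZMod k, i ≠ 0 → ∀ j : ZMod l, j ≠ 1 → D (Sum.inl i : V k l) (Sum.inr j) := by
    intro i hi j hj
    have := D_cc hkl j (h1 i)
    rw [cc_inl hi, y0, cc_inr (one_ne.symm) j (by simpa using hj)] at this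
    simpa using this
  have h3 : ∀ i : ZMod k, i ≠ 0 → D (Sum.inl i : V k l) (Sum.inl 0) := by
    intro i hi
    have := D_cc hkl 1 (h1 i)
    rw [cc_inl hi, y0, cc_inr' (one_ne.symm) 1 (by simp)] at this
    exact this
  have h4 : ∀ i i' : ZMod k, i ≠ i' → D (Sum.inl i : V k l) (Sum.inl i') := by
    intro i i' h
    have := D_rot hkl i' (h3 (i - i') (sub_ne_zero.mpr h))
    simpa [rot] using this
  have h5 : ∀ i : ZMod k, ∀ j : ZMod l, j ≠ 1 → D (Sum.inl i : V k l) (Sum.inr j) := by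
    intro i j hj
    have := D_rot hkl (i - 1) (h2 1 one_ne j hj)
    simpa [rot] using this
  have h6 : ∀ i : ZMod k, ∀ j : ZMod l, j ≠ 1 → D (Sum.inr j : V k l) (Sum.inl i) := by
    intro i j hj
    have hj' : j - 1 ≠ 0 := sub_ne_zero.mpr hj
    -- from `(x0, inr (2 - j))` rotate by `j - 1`
    have := D_cc hkl (j - 1) (h5 0 (1 - (j - 1)) (by simpa using hj'))
    rw [cc_x0 _ hj', cc_inr' (by simpa using hj') _ (by ring)] at this
    have := D_rot hkl i this
    simpa [rot] using this
  have h7 : ∀ j j' : ZMod l, j ≠ 1 → j' ≠ 1 → j ≠ j' → D (Sum.inr j : V k l) (Sum.inr j') := by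
    intro j j' hj hj' hne
    have hj1 : j - 1 ≠ 0 := sub_ne_zero.mpr hj
    have hq : j' - (j - 1) ≠ 1 := by
      intro h; apply hne
      linear_combination -h
    have := D_cc hkl (j - 1) (h5 0 (j' - (j - 1)) hq)
    rw [cc_x0 _ hj1, cc_inr hq _ (by simpa using hj')] at this
    simpa using this
  rcases x with i | j <;> rcases y with i' | j'
  · exact h4 i i' (by simpa using hxy)
  · exact h5 i j' (by simpa [z] using hy)
  · exact h6 i' j (by simpa [z] using hx)
  · exact h7 j j' (by simpa [z] using hx) (by simpa [z] using hy) (by simpa using hxy)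

/-- Admissible noninjective maps of the complement of `z`. -/
theorem Adm_all (hkl : Nat.Coprime k l) (h : V k l → V k l) (hz : ∀ x, x ≠ z → h x ≠ z)
    (hni : ∃ x y, x ≠ z ∧ y ≠ z ∧ x ≠ y ∧ h x = h y) : Adm h := by
  let T := {x : V k l // x ≠ z}
  let P : (T → T) → Prop := fun f => ∀ h : V k l → V k l,
    (∀ t : T, h t = f t) → Adm h
  have hP : P (fun t => ⟨h t, hz t t.2⟩) := by
    refine howie P ?_ ?_ _ _ le_rfl ?_
    · intro f g hf hg h hh
      let ext : (T → T) → V k l → V k l := fun f x => if hx : x ≠ z then (f ⟨x, hx⟩ : V k l) else z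
      have e : ∀ (f : T → T) (t : T), ext f t = f t := by
        intro f t; simp [ext, t.2]
      refine Adm_congr (Adm_comp (hf _ (e f)) (hg _ (e g))) fun x hx => ?_
      have h1 := hh ⟨x, hx⟩
      have h2 := e g ⟨x, hx⟩
      simp only at h1 h2
      rw [comp_apply, h2, e, h1]; rfl
    · intro x y hxy h hh
      refine Adm_congr (D_all hkl x y x.2 y.2 (fun e => hxy (Subtype.ext e))) fun v hv => ?_
      have h1 := hh ⟨v, hv⟩
      simp only at h1
      rw [h1]
      simp only [update_apply, id]
      by_cases hvx : v = x
      · have : (⟨v, hv⟩ : T) = x := Subtype.ext hvx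
        simp [hvx]
      · have : (⟨v, hv⟩ : T) ≠ x := fun e => hvx (congrArg Subtype.val e)
        simp [hvx, this]
    · obtain ⟨x, y, hx, hy, hxy, he⟩ := hni
      intro hi
      have := @hi ⟨x, hx⟩ ⟨y, hy⟩ (Subtype.ext he)
      exact hxy (congrArg Subtype.val this)
  exact hP h fun t => rfl

/-- The maps we prove to be generated. -/
def Gd (f : V k l → V k l) : Prop :=
  ∃ i j, f (Sum.inl i) = f (Sum.inr j) ∧ (∃ x y, x ≠ Sum.inl i ∧ y ≠ Sum.inl i ∧ x ≠ y ∧ f x = f y) ∧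
    ∃ b, ∀ x, f x ≠ Sum.inr b

theorem G_of_Gd (hkl : Nat.Coprime k l) (f : V k l → V k l) (hf : Gd f) : G f := by
  obtain ⟨i, j, hij, ⟨x, y, hx, hy, hxy, hfxy⟩, b, hb⟩ := hf
  let f' : V k l → V k l := rot 0 (1 - b) ∘ f ∘ rot i j
  have hx0 : f' x0 = f' y0 := by simp [f', rot, x0, y0, hij]
  have hz : ∀ x, f' x ≠ z := by
    intro x
    have := hb (rot i j x)
    simp only [f', comp_apply]
    rcases h : f (rot i j x) with u | u
    · simp [rot, z]
    · rw [h] at this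
      simp only [rot, z, Sum.map_inr, ne_eq, Sum.inr.injEq] at this ⊢
      intro e; apply this; linear_combination e
  have hA : Adm (f' ∘ Equiv.swap x0 z) := by
    apply Adm_all hkl
    · intro x _; exact hz _
    · have e : ∀ v : V k l, rot i j (rot (-i) (-j) v) = v := by
        intro v; simp [rot_rot, rot_zero]
      have e' : ∀ v : V k l, v ≠ Sum.inl i → rot (-i) (-j) v ≠ x0 := by
        intro v hv h
        apply hv; rw [← e v, h]; simp [rot, x0]
      have e3 : ∀ v : V k l, v ≠ x0 → Equiv.swap x0 z v ≠ z := by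
        intro v hv h
        apply hv
        have := congrArg (Equiv.swap x0 z) h
        simpa using this
      refine ⟨Equiv.swap x0 z (rot (-i) (-j) x), Equiv.swap x0 z (rot (-i) (-j) y),
        e3 _ (e' x hx), e3 _ (e' y hy), ?_, ?_⟩
      · intro h
        have := (Equiv.swap x0 z).injective h
        apply hxy
        rw [← e x, this, e]
      · simp [f', e, hfxy]
  have hG := (hA bet bet_ne_z G_bet).1
  have hf' : (f' ∘ Equiv.swap x0 z) ∘ bet = f' := by
    funext v
    have a1 : (x0 : V k l) ≠ z := by simp [x0, z]
    have a2 : (y0 : V k l) ≠ z := by simp [y0, z]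
    have a3 : (y0 : V k l) ≠ x0 := by simp [y0, x0]
    simp only [comp_apply, bet, Equiv.swap_apply_def]
    grind
  rw [hf'] at hG
  have := G_comp (G_rot hkl 0 (b - 1)) (G_comp hG (G_rot hkl (-i) (-j)))
  convert this using 1
  funext v
  simp [f', rot_rot, rot_zero]

end RootSC
namespace RootSC

open Function

variable {k l : ℕ} [NeZero k] [NeZero l] [Fact (1 < k)] [Fact (1 < l)]

def Per (f : V k l → V k l) : Prop := ∃ m : ℕ, 1 ≤ m ∧ f^[m] x0 = x0

theorem not_per {f : V k l → V k l} {c : V k l} (hc : c ≠ x0) (h1 : f x0 = c) (h2 : f c = c) :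
    ¬ Per f := by
  rintro ⟨m, hm, h⟩
  obtain ⟨m, rfl⟩ : ∃ m', m = m' + 1 := ⟨m - 1, by omega⟩
  rw [iterate_succ_apply, h1, iterate_fixed h2] at h
  exact hc h

def mu (p d c : V k l) (x : V k l) : V k l := if x = p then d else c

def NC (f : V k l → V k l) : Prop := ¬ ∃ c, ∀ x, x ≠ x0 → f x = c

theorem dist_aux (f1 f2 : V k l → V k l) (hne : f1 ≠ f2) (hf2 : NC f2) :
    ∃ p d c, ¬ (Per (mu p d c ∘ f1) ↔ Per (mu p d c ∘ f2)) := by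
  by_cases h0 : f1 x0 = f2 x0
  · obtain ⟨x, hx⟩ := Function.ne_iff.mp hne
    have hxx : x ≠ x0 := by rintro rfl; exact hx h0
    by_cases h2 : f2 x = f2 x0
    · -- then `f1 x ≠ f1 x0`
      have h1 : f1 x ≠ f1 x0 := by rw [h0, ← h2]; exact hx
      refine ⟨f1 x, x0, x, fun h => ?_⟩
      refine not_per (f := mu (f1 x) x0 x ∘ f2) hxx ?_ ?_ (h.mp ⟨2, by norm_num, ?_⟩)
      · simp [mu, ← h0, h1.symm]
      · simp [mu, hx.symm]
      · simp [mu, h1.symm]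
    · refine ⟨f2 x, x0, x, fun h => ?_⟩
      refine not_per (f := mu (f2 x) x0 x ∘ f1) hxx ?_ ?_ (h.mpr ⟨2, by norm_num, ?_⟩)
      · simp [mu, h0, Ne.symm h2]
      · simp [mu, hx]
      · simp [mu, Ne.symm h2]
  · obtain ⟨c, hc, hc2⟩ : ∃ c, c ≠ x0 ∧ f2 c ≠ f1 x0 := by
      by_contra hcon
      push Not at hcon
      exact hf2 ⟨_, hcon⟩
    refine ⟨f1 x0, x0, c, fun h => ?_⟩
    refine not_per (f := mu (f1 x0) x0 c ∘ f2) hc ?_ ?_ (h.mp ⟨1, le_rfl, ?_⟩)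
    · simp [mu, Ne.symm h0]
    · simp [mu, hc2]
    · simp [mu]

theorem Gd_mu (hk : 3 ≤ k) (hl : 4 ≤ l) (p d c : V k l) : Gd (mu p d c) := by
  have hkc : Fintype.card (ZMod k) = k := ZMod.card k
  have hlc : Fintype.card (ZMod l) = l := ZMod.card l
  have avk : ∀ s : Finset (ZMod k), s.card ≤ 1 → ∃ i, i ∉ s := by
    intro s hs
    by_contra hcon; push Not at hcon
    have : s = Finset.univ := by ext; simp [hcon]
    rw [this, Finset.card_univ, hkc] at hs; omega
  have avl : ∀ s : Finset (ZMod l), s.card ≤ 3 → ∃ i, i ∉ s := by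
    intro s hs
    by_contra hcon; push Not at hcon
    have : s = Finset.univ := by ext; simp [hcon]
    rw [this, Finset.card_univ, hlc] at hs; omega
  obtain ⟨pi, hpi⟩ : ∃ pi : ZMod k, ∀ i, i ≠ pi → (Sum.inl i : V k l) ≠ p := by
    rcases p with a | a
    · exact ⟨a, by simp⟩
    · exact ⟨0, by simp⟩
  have gj : ∀ p : V k l, ∃ pi : ZMod l, ∀ i, i ≠ pi → (Sum.inr i : V k l) ≠ p := by
    intro p
    rcases p with a | a
    · exact ⟨0, by simp⟩
    · exact ⟨a, by simp⟩
  obtain ⟨pj, hpj⟩ := gj p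
  obtain ⟨cj, hcj⟩ := gj c
  obtain ⟨dj, hdj⟩ := gj d
  obtain ⟨i, hi⟩ := avk {pi} (by simp)
  obtain ⟨j, hj⟩ := avl {pj} (by simp)
  obtain ⟨j', hj'⟩ := avl {pj, j} (Finset.card_le_two.trans (by norm_num))
  obtain ⟨b, hb⟩ := avl {cj, dj} (Finset.card_le_two.trans (by norm_num))
  simp only [Finset.mem_singleton, Finset.mem_insert, not_or] at hi hj hj' hb
  have e1 := hpi i hi
  have e2 := hpj j hj
  have e3 := hpj j' hj'.1
  have e4 := hcj b hb.1
  have e5 := hdj b hb.2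
  refine ⟨i, j, by simp [mu, e1, e2], ⟨Sum.inr j, Sum.inr j', by simp, by simp,
    by simpa using Ne.symm hj'.2, by simp [mu, e2, e3]⟩, b, fun x => ?_⟩
  unfold mu
  split_ifs
  · exact e5.symm
  · exact e4.symm

theorem eval_flatten (w : List (Fin 2)) (f : V k l → V k l)
    (hw : ∀ x, (aut k l).evalFrom x w = f x) (m : ℕ) :
    ∀ x, (aut k l).evalFrom x (List.replicate m w).flatten = f^[m] x := by
  induction m with
  | zero => intro x; simp
  | succ m ih =>
    intro x
    rw [List.replicate_succ, List.flatten_cons, DFA.evalFrom_of_append, hw, ih,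
      iterate_succ_apply]

theorem mem_root (w : List (Fin 2)) (f : V k l → V k l)
    (hw : ∀ x, (aut k l).evalFrom x w = f x) :
    w ∈ root (aut k l).accepts ↔ Per f := by
  have : ∀ m : ℕ, (List.replicate m w).flatten ∈ (aut k l).accepts ↔ f^[m] x0 = x0 := by
    intro m
    rw [DFA.mem_accepts, DFA.eval, eval_flatten w f hw]
    rfl
  show (∃ m : ℕ, 1 ≤ m ∧ (List.replicate m w).flatten ∈ (aut k l).accepts) ↔ _
  simp only [this]; rfl

/-- A DFA for the root language. -/
def rootAut (k l : ℕ) : DFA (Fin 2) (V k l → V k l) where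
  step f a := fun x => (aut k l).step (f x) a
  start := id
  accept := {f | ∃ m : ℕ, 1 ≤ m ∧ f^[m] x0 = x0}

theorem rootAut_eval (w : List (Fin 2)) : ∀ f : V k l → V k l, (rootAut k l).evalFrom f w =
    fun x => (aut k l).evalFrom (f x) w := by
  induction w with
  | nil => intro f; rfl
  | cons a w ih => intro f; rw [DFA.evalFrom_cons, ih]; rfl

theorem rootAut_accepts : (rootAut k l).accepts = root (aut k l).accepts := by
  ext w
  rw [mem_root w _ (fun x => rfl), DFA.mem_accepts, DFA.eval, rootAut_eval]
  rfl

theorem sc_root_ge (hkl : Nat.Coprime k l) (hk : 3 ≤ k) (hl : 4 ≤ l)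
    (S : Finset (V k l → V k l)) (hS : ∀ f ∈ S, Gd f ∧ NC f) :
    S.card ≤ sc (root (aut k l).accepts) := by
  have hne : {m | ∃ (σ : Type) (_ : Fintype σ) (M : DFA (Fin 2) σ),
      M.accepts = root (aut k l).accepts ∧ Fintype.card σ = m}.Nonempty :=
    ⟨_, _, inferInstance, rootAut k l, rootAut_accepts, rfl⟩
  obtain ⟨σ, _, M, hM, hcard⟩ := Nat.sInf_mem hne
  change S.card ≤ sInf _
  rw [← hcard, ← Fintype.card_coe]
  have hG : ∀ f : S, G f.1 := fun f => G_of_Gd hkl _ (hS f.1 f.2).1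
  choose w hw using hG
  refine Fintype.card_le_of_injective (fun f => M.eval (w f)) ?_
  intro f1 f2 he
  by_contra hne
  obtain ⟨p, d, c, hpd⟩ := dist_aux f1.1 f2.1 (fun e => hne (Subtype.ext e)) (hS f2.1 f2.2).2
  obtain ⟨u, hu⟩ := G_of_Gd hkl _ (Gd_mu hk hl p d c)
  apply hpd
  have key : ∀ f : S, (w f ++ u ∈ M.accepts ↔ Per (mu p d c ∘ f.1)) := by
    intro f
    rw [hM]
    apply mem_root
    intro x
    rw [DFA.evalFrom_of_append, hw, hu]; rfl
  rw [← key, ← key, DFA.mem_accepts, DFA.mem_accepts, DFA.eval, DFA.evalFrom_of_append,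
    DFA.evalFrom_of_append]
  simp only [DFA.eval] at he
  rw [he]

theorem sc_le : IsReg (aut k l).accepts ∧ sc (aut k l).accepts ≤ k + l := by
  refine ⟨⟨_, inferInstance, aut k l, rfl⟩, ?_⟩
  apply Nat.sInf_le
  refine ⟨_, inferInstance, aut k l, rfl, ?_⟩
  simp [ZMod.card]

end RootSC
namespace RootSC

open Function Finset

section count

variable {T : Type} [Fintype T] [DecidableEq T]

theorem sum_coord (p : T) (H : (T → T) → ℝ) (c : ℝ)
    (h : ∀ f, ∑ v, H (update f p v) = c) :
    (Fintype.card T : ℝ) * ∑ f, H f = c * (Fintype.card T : ℝ) ^ (Fintype.card T) := by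
  have e : ∑ f : T → T, ∑ v, H (update f p v) = (Fintype.card T : ℝ) * ∑ f, H f := by
    have key : ∀ F : (T → T) → ℝ, ∑ f, F f =
        ∑ g : {j // j ≠ p} → T, ∑ u : T, F ((Equiv.funSplitAt p T).symm (u, g)) := by
      intro F
      rw [← Equiv.sum_comp (Equiv.funSplitAt p T).symm F, Fintype.sum_prod_type, Finset.sum_comm]
    rw [key, key H, Finset.mul_sum]
    refine Finset.sum_congr rfl fun g _ => ?_
    have hu : ∀ u v : T, update ((Equiv.funSplitAt p T).symm (u, g)) p v =
        (Equiv.funSplitAt p T).symm (v, g) := by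
      intro u v
      funext t
      by_cases ht : t = p
      · subst ht; simp
      · simp [ht]
    simp only [hu]
    simp
  rw [← e]
  simp only [h]
  simp [mul_comm]

/-- centered collision indicator -/
noncomputable def Yc (p q : T) (f : T → T) : ℝ :=
  (if f p = f q then 1 else 0) - 1 / (Fintype.card T : ℝ)

theorem sum_Yc_update [Nonempty T] (p q : T) (hpq : p ≠ q) (f : T → T) :
    ∑ v, Yc p q (update f p v) = 0 := by
  have : (Fintype.card T : ℝ) ≠ 0 := by simp
  simp [Yc, Finset.sum_sub_distrib, update_apply, hpq.symm, this]

theorem Yc_comm (p q : T) : Yc p q = Yc q p := by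
  funext f; simp [Yc, eq_comm]

theorem sum_Yc_mul [Nonempty T] (p q r s : T) (hpq : p ≠ q) (hr : r ≠ p) (hs : s ≠ p) :
    ∑ f, Yc p q f * Yc r s f = 0 := by
  have hn : (Fintype.card T : ℝ) ≠ 0 := by simp
  have := sum_coord p (fun f => Yc p q f * Yc r s f) 0 (by
    intro f
    have : ∀ v, Yc r s (update f p v) = Yc r s f := by
      intro v; simp [Yc, hr, hs]
    simp only [this]
    rw [← Finset.sum_mul, sum_Yc_update p q hpq, zero_mul])
  rw [zero_mul] at this
  exact (mul_eq_zero.mp this).resolve_left hn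

theorem sum_Yc_sq [Nonempty T] (p q : T) (hpq : p ≠ q) :
    (Fintype.card T : ℝ) * ∑ f, Yc p q f * Yc p q f =
      (1 - 1 / (Fintype.card T : ℝ)) * (Fintype.card T : ℝ) ^ (Fintype.card T) := by
  have hn : (Fintype.card T : ℝ) ≠ 0 := by simp
  apply sum_coord p
  intro f
  have : ∀ v, Yc p q (update f p v) * Yc p q (update f p v) =
      (if v = f q then (1 - 2 / (Fintype.card T : ℝ)) else 0) + 1 / (Fintype.card T : ℝ) ^ 2 := by
    intro v
    simp only [Yc, update_self, update_of_ne hpq.symm]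
    split_ifs
    · field_simp; ring
    · field_simp; ring
  simp only [this, Finset.sum_add_distrib]
  simp
  field_simp
  ring

end count

variable {k l : ℕ} [NeZero k] [NeZero l]

/-- number of cross collisions -/
noncomputable def X (f : V k l → V k l) : ℝ :=
  ∑ p : ZMod k × ZMod l, if f (Sum.inl p.1) = f (Sum.inr p.2) then 1 else 0

theorem card_V : Fintype.card (V k l) = k + l := by simp [ZMod.card]

theorem second_moment :
    ∑ f : V k l → V k l, (X f - k * l / (k + l : ℕ)) ^ 2 =
      (k * l / (k + l : ℕ) : ℝ) * (1 - 1 / (k + l : ℕ)) * ((k + l : ℕ) : ℝ) ^ (k + l) := by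
  have hcard : Fintype.card (V k l) = k + l := card_V
  have hn : ((k + l : ℕ) : ℝ) ≠ 0 := by
    have := NeZero.ne k
    exact_mod_cast (by omega : k + l ≠ 0)
  have hX : ∀ f : V k l → V k l, X f - k * l / (k + l : ℕ) =
      ∑ p : ZMod k × ZMod l, Yc (Sum.inl p.1 : V k l) (Sum.inr p.2) f := by
    intro f
    simp only [Yc, Finset.sum_sub_distrib, hcard, X]
    congr 1
    simp [ZMod.card]
    ring
  simp only [hX, sq, Finset.sum_mul_sum]
  rw [Finset.sum_comm]
  have h1 : ∀ p : ZMod k × ZMod l, ∑ f : V k l → V k l, ∑ q : ZMod k × ZMod l,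
      Yc (Sum.inl p.1 : V k l) (Sum.inr p.2) f * Yc (Sum.inl q.1 : V k l) (Sum.inr q.2) f =
      (1 - 1 / ((k + l : ℕ) : ℝ)) * ((k + l : ℕ) : ℝ) ^ (k + l) / (k + l : ℕ) := by
    intro p
    rw [Finset.sum_comm, Finset.sum_eq_single p]
    · have := sum_Yc_sq (Sum.inl p.1 : V k l) (Sum.inr p.2) (by simp)
      rw [hcard] at this
      rw [← this]; field_simp
    · rintro ⟨i', j'⟩ _ hne
      obtain ⟨i, j⟩ := p
      by_cases hi : i = i'
      · subst hi
        have hj : j ≠ j' := by rintro rfl; exact hne rfl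
        simp only
        rw [Yc_comm (Sum.inl i : V k l) (Sum.inr j)]
        exact sum_Yc_mul _ _ _ _ (by simp) (by simp) (by simpa using hj.symm)
      · exact sum_Yc_mul _ _ _ _ (by simp) (by simpa using Ne.symm hi) (by simp)
    · simp
  simp only [h1]
  simp [ZMod.card]
  ring

open Classical in
theorem card_few (hm : (1 : ℝ) < k * l / (k + l : ℕ)) :
    ((univ.filter fun f : V k l → V k l => X f ≤ 1).card : ℝ) * ((k * l / (k + l : ℕ) : ℝ) - 1) ^ 2 ≤
      (k * l / (k + l : ℕ) : ℝ) * (1 - 1 / (k + l : ℕ)) * ((k + l : ℕ) : ℝ) ^ (k + l) := by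
  rw [← second_moment, ← nsmul_eq_mul, ← Finset.sum_const]
  refine (Finset.sum_le_sum ?_).trans (Finset.sum_le_sum_of_subset_of_nonneg (Finset.filter_subset _ _) ?_)
  · intro f hf
    have := (Finset.mem_filter.mp hf).2
    nlinarith
  · intros; positivity

open Classical in
theorem card_cover :
    (univ.filter fun f : V k l → V k l => ∀ b, ∃ x, f x = Sum.inr b).card ≤
      (k + l).descFactorial l * (k + l) ^ k := by
  have hcard : Fintype.card (V k l) = k + l := card_V
  have hsub : (univ.filter fun f : V k l → V k l => ∀ b, ∃ x, f x = Sum.inr b) ⊆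
      (univ : Finset (ZMod l ↪ V k l)).biUnion fun s =>
        univ.filter fun f : V k l → V k l => ∀ b, f (s b) = Sum.inr b := by
    intro f hf
    have := (Finset.mem_filter.mp hf).2
    choose s hs using this
    rw [Finset.mem_biUnion]
    refine ⟨⟨s, fun a b h => ?_⟩, Finset.mem_univ _, ?_⟩
    · have := hs a
      rw [h, hs b] at this
      simpa using this.symm
    · simp only [Finset.mem_filter, Finset.mem_univ, true_and]; exact hs
  refine (Finset.card_le_card hsub).trans ?_
  refine (Finset.card_biUnion_le_card_mul _ _ ((k + l) ^ k) ?_).trans ?_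
  · intro s _
    have hk : Fintype.card {x : V k l // x ∉ Set.range s} = k := by
      rw [Fintype.card_subtype_compl, hcard]
      have : Fintype.card {x : V k l // x ∈ Set.range s} = l := by
        have := (Fintype.card_congr (Equiv.ofInjective s s.injective)).symm.trans (ZMod.card l)
        convert this
      rw [this]; omega
    have : Fintype.card ({x : V k l // x ∉ Set.range s} → V k l) = (k + l) ^ k := by
      rw [Fintype.card_fun, hcard, hk]
    rw [← this, ← Finset.card_univ]
    refine Finset.card_le_card_of_injOn (fun f x => f x.1) (fun _ _ => by simp) ?_
    intro f hf g hg h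
    have hf' : ∀ b, f (s b) = Sum.inr b := by simpa using hf
    have hg' : ∀ b, g (s b) = Sum.inr b := by simpa using hg
    funext x
    by_cases hx : x ∈ Set.range s
    · obtain ⟨b, rfl⟩ := hx
      rw [hf', hg']
    · exact congrFun h ⟨x, hx⟩
  · rw [Finset.card_univ, Fintype.card_embedding_eq, hcard, ZMod.card]

open Classical in
theorem card_const [Fact (1 < k)] :
    (univ.filter fun f : V k l → V k l => ¬ NC f).card ≤ (k + l) ^ 2 := by
  have hcard : Fintype.card (V k l × V k l) = (k + l) ^ 2 := by
    rw [Fintype.card_prod, card_V, sq]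
  rw [← hcard, ← Finset.card_univ]
  refine Finset.card_le_card_of_injOn (fun f => (f x0, f (Sum.inl 1))) (fun _ _ => by simp) ?_
  intro f hf g hg h
  have hf' : ¬ NC f := by simpa using hf
  have hg' : ¬ NC g := by simpa using hg
  obtain ⟨c, hc⟩ := not_not.mp hf'
  obtain ⟨d, hd⟩ := not_not.mp hg'
  simp only [Prod.mk.injEq] at h
  have h1 : (Sum.inl 1 : V k l) ≠ x0 := by simp [x0]
  funext x
  by_cases hx : x = x0
  · rw [hx, h.1]
  · rw [hc x hx, hd x hx, ← hc _ h1, ← hd _ h1, h.2]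

theorem Gd_of (f : V k l → V k l) (hX : 1 < X f) (hb : ¬ ∀ b, ∃ x, f x = Sum.inr b) : Gd f := by
  have h2 : 1 < (univ.filter fun p : ZMod k × ZMod l => f (Sum.inl p.1) = f (Sum.inr p.2)).card := by
    have : X f = ((univ.filter fun p : ZMod k × ZMod l =>
      f (Sum.inl p.1) = f (Sum.inr p.2)).card : ℝ) := by simp [X]
    rw [this] at hX
    exact_mod_cast hX
  obtain ⟨⟨i, j⟩, hp, ⟨i', j'⟩, hq, hne⟩ := Finset.one_lt_card.mp h2
  simp only [Finset.mem_filter, Finset.mem_univ, true_and] at hp hq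
  push Not at hb
  refine ⟨i, j, hp, ?_, hb⟩
  by_cases hi : i = i'
  · subst hi
    have hj : j ≠ j' := by rintro rfl; exact hne rfl
    exact ⟨Sum.inr j, Sum.inr j', by simp, by simp, by simpa using hj, by rw [← hp, ← hq]⟩
  · exact ⟨Sum.inl i', Sum.inr j', by simpa using Ne.symm hi, by simp, by simp, hq⟩

theorem sc_bound [Fact (1 < k)] [Fact (1 < l)] (hkl : Nat.Coprime k l) (hk : 3 ≤ k) (hl : 4 ≤ l)
    (n : ℕ) (hn : n = k + l)
    (m : ℝ) (hm : m = k * l / n) (hm1 : 1 < m) :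
    (n : ℝ) ^ n - (n : ℝ) ^ n * (m * (1 - 1 / n) / (m - 1) ^ 2)
      - n.descFactorial l * (n : ℝ) ^ k - (n : ℝ) ^ 2 ≤ sc (root (aut k l).accepts) := by
  classical
  subst hn
  set S1 := univ.filter fun f : V k l → V k l => X f ≤ 1 with hS1
  set S2 := univ.filter fun f : V k l → V k l => ∀ b, ∃ x, f x = Sum.inr b with hS2
  set S3 := univ.filter fun f : V k l → V k l => ¬ NC f with hS3
  have hS := sc_root_ge hkl hk hl (((univ \ S1) \ S2) \ S3) (by
    intro f hf
    simp only [hS1, hS2, hS3, Finset.mem_sdiff, Finset.mem_univ, true_and, Finset.mem_filter,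
      not_not, not_le] at hf
    exact ⟨Gd_of f hf.1.1 hf.1.2, hf.2⟩)
  have c1 := Finset.le_card_sdiff S1 (univ : Finset (V k l → V k l))
  have c2 := Finset.le_card_sdiff S2 (univ \ S1)
  have c3 := Finset.le_card_sdiff S3 ((univ \ S1) \ S2)
  have cu : (univ : Finset (V k l → V k l)).card = (k + l) ^ (k + l) := by
    rw [Finset.card_univ, Fintype.card_fun, card_V]
  rw [cu] at c1
  have d2 : S2.card ≤ _ := card_cover
  have d3 : S3.card ≤ _ := card_const
  have d1 : (S1.card : ℝ) * _ ≤ _ := card_few (by rw [← hm]; exact hm1)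
  rw [← hm] at d1
  have hpos : 0 < (m - 1) ^ 2 := by apply pow_pos; linarith
  have d1' : (S1.card : ℝ) ≤ ((k + l : ℕ) : ℝ) ^ (k + l) *
      (m * (1 - 1 / (k + l : ℕ)) / (m - 1) ^ 2) := by
    rw [← mul_div_assoc, le_div_iff₀ hpos]
    linarith
  have tot : (k + l) ^ (k + l) ≤ sc (root (aut k l).accepts) + S1.card +
      (k + l).descFactorial l * (k + l) ^ k + (k + l) ^ 2 := by omega
  have tot' : (((k + l) ^ (k + l) : ℕ) : ℝ) ≤ ((sc (root (aut k l).accepts) + S1.card +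
      (k + l).descFactorial l * (k + l) ^ k + (k + l) ^ 2 : ℕ) : ℝ) := by exact_mod_cast tot
  push_cast at tot' d1' ⊢
  linarith

end RootSC
namespace RootSC

theorem desc_bound (n : ℕ) (hn : 0 < n) : ∀ l : ℕ, l ≤ n →
    (n.descFactorial l : ℝ) * (1 + l * (l - 1) / (2 * n)) ≤ (n : ℝ) ^ l := by
  intro l
  induction l with
  | zero => intro _; simp
  | succ l ih =>
    intro hl
    have h := ih (by omega)
    have hn' : (0 : ℝ) < n := by exact_mod_cast hn
    have hln : (l : ℝ) + 1 ≤ n := by exact_mod_cast hl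
    have hl0 : (0 : ℝ) ≤ l := Nat.cast_nonneg l
    rw [Nat.descFactorial_succ, Nat.cast_mul, Nat.cast_sub (by omega), pow_succ]
    have hD : (0 : ℝ) ≤ n.descFactorial l := Nat.cast_nonneg _
    have key : ((n : ℝ) - l) * (1 + ((l + 1 : ℕ) : ℝ) * (((l + 1 : ℕ) : ℝ) - 1) / (2 * n)) ≤
        (1 + l * (l - 1) / (2 * n)) * n := by
      push_cast
      have : (1 + (l : ℝ) * (l - 1) / (2 * n)) * n -
          ((n : ℝ) - l) * (1 + ((l : ℝ) + 1) * ((l : ℝ) + 1 - 1) / (2 * n)) =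
          l * l * (l + 1) / (2 * n) := by
        field_simp; ring
      have h2 : 0 ≤ (l : ℝ) * l * (l + 1) / (2 * n) := by positivity
      linarith
    calc _ = (n.descFactorial l : ℝ) * (((n : ℝ) - l) *
          (1 + ((l + 1 : ℕ) : ℝ) * (((l + 1 : ℕ) : ℝ) - 1) / (2 * n))) := by ring
      _ ≤ (n.descFactorial l : ℝ) * ((1 + l * (l - 1) / (2 * n)) * n) :=
          mul_le_mul_of_nonneg_left key hD
      _ = ((n.descFactorial l : ℝ) * (1 + l * (l - 1) / (2 * n))) * n := by ring
      _ ≤ _ := mul_le_mul_of_nonneg_right h hn'.le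

theorem q_bound (n : ℕ) (hn : 0 < n) (q : ℝ) (hq : q ^ 2 * n ≤ 9.36) :
    q ≤ Real.sqrt 8 * Real.exp (1 / 12) / Real.sqrt n := by
  have hn' : (0 : ℝ) < n := by exact_mod_cast hn
  have hs : 0 < Real.sqrt n := Real.sqrt_pos.mpr hn'
  rw [le_div_iff₀ hs]
  have he : (13 / 12 : ℝ) ≤ Real.exp (1 / 12) := by
    have := Real.add_one_le_exp (1 / 12 : ℝ); linarith
  have h8 : 0 ≤ Real.sqrt 8 := Real.sqrt_nonneg _
  have h1 : Real.sqrt 8 * (13 / 12) ≤ Real.sqrt 8 * Real.exp (1 / 12) :=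
    mul_le_mul_of_nonneg_left he h8
  refine le_trans ?_ h1
  apply le_of_sq_le_sq _ (by positivity)
  rw [mul_pow, mul_pow, Real.sq_sqrt hn'.le, Real.sq_sqrt (by norm_num)]
  norm_num at hq ⊢
  linarith

def Concl (n : ℕ) : Prop := ∃ L : Language (Fin 2), IsReg L ∧ sc L ≤ n ∧
      ((sc (root L) : ℝ) ≥ (n : ℝ) ^ n *
        (1 - Real.sqrt 2 * (2 / Real.exp 1) ^ ((n : ℝ) / 2) * Real.exp (1 / 12)
          - Real.sqrt 8 * Real.exp (1 / 12) / Real.sqrt n)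
        - (n : ℝ) * ((n : ℝ) - 1) / 2)

theorem main_step (k l n : ℕ) (hn : n = k + l) (hkl : Nat.Coprime k l) (hk : 3 ≤ k) (hl : 4 ≤ l)
    (hm : n < k * l) (q : ℝ)
    (hq : (k : ℝ) * l * (n - 1) / (k * l - n) ^ 2 + (n.descFactorial l : ℝ) / (n : ℝ) ^ l
      + 1 / (n : ℝ) ^ 2 ≤ q)
    (hq2 : q ^ 2 * n ≤ 9.36) : Concl n := by
  haveI : NeZero k := ⟨by omega⟩
  haveI : NeZero l := ⟨by omega⟩
  haveI : Fact (1 < k) := ⟨by omega⟩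
  haveI : Fact (1 < l) := ⟨by omega⟩
  refine ⟨(aut k l).accepts, sc_le.1, hn ▸ sc_le.2, ?_⟩
  have hn0 : (0 : ℝ) < n := by exact_mod_cast (by omega : 0 < n)
  have hn1 : (1 : ℝ) ≤ n := by exact_mod_cast (by omega : 1 ≤ n)
  have hmR : (n : ℝ) < k * l := by exact_mod_cast hm
  have hm1 : (1 : ℝ) < k * l / n := by rw [lt_div_iff₀ hn0]; linarith
  have hb := sc_bound hkl hk hl n hn _ rfl hm1
  have hqb := q_bound n (by omega) q hq2
  have e1 : ((k : ℝ) * l / n) * (1 - 1 / n) / ((k : ℝ) * l / n - 1) ^ 2 =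
      (k : ℝ) * l * (n - 1) / (k * l - n) ^ 2 := by
    have : (k : ℝ) * l - n ≠ 0 := by linarith
    field_simp
  have e2 : (n.descFactorial l : ℝ) * (n : ℝ) ^ k =
      (n : ℝ) ^ n * ((n.descFactorial l : ℝ) / (n : ℝ) ^ l) := by
    have : (n : ℝ) ^ n = (n : ℝ) ^ k * (n : ℝ) ^ l := by rw [← pow_add, ← hn]
    rw [this]; field_simp
  have e3 : (n : ℝ) ^ 2 ≤ (n : ℝ) ^ n * (1 / (n : ℝ) ^ 2) := by
    rw [mul_one_div, le_div_iff₀ (by positivity), ← pow_add]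
    exact pow_le_pow_right₀ hn1 (by omega)
  have hT : 0 ≤ Real.sqrt 2 * (2 / Real.exp 1) ^ ((n : ℝ) / 2) * Real.exp (1 / 12) := by positivity
  have hN : (0 : ℝ) ≤ (n : ℝ) ^ n := by positivity
  have h4 : (0 : ℝ) ≤ (n : ℝ) * ((n : ℝ) - 1) / 2 := by
    have : 0 ≤ (n : ℝ) - 1 := by linarith
    positivity
  rw [e1, e2] at hb
  have h5 := mul_le_mul_of_nonneg_left (hq.trans (hqb.trans (le_add_of_nonneg_left hT))) hN
  rw [ge_iff_le]
  linarith

theorem exists_kl (n : ℕ) (hn : 25 ≤ n) : ∃ k l : ℕ, n = k + l ∧ Nat.Coprime k l ∧ 3 ≤ k ∧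
    n ≤ 2 * l ∧ n * n ≤ 4 * (k * l) + 16 := by
  obtain ⟨r, hr⟩ : ∃ r, n = 2 * r + 1 ∨ n = 4 * r ∨ n = 4 * r + 2 := by
    rcases Nat.even_or_odd' n with ⟨s, h | h⟩
    · rcases Nat.even_or_odd' s with ⟨t, h' | h'⟩
      · exact ⟨t, by omega⟩
      · exact ⟨t, by omega⟩
    · exact ⟨s, by omega⟩
  rcases hr with h | h | h
  · refine ⟨r, r + 1, by omega, by simp, by omega, by omega, ?_⟩
    subst h; nlinarith
  · obtain ⟨s, rfl⟩ : ∃ s, r = s + 1 := ⟨r - 1, by omega⟩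
    refine ⟨2 * s + 1, 2 * s + 1 + 2, by omega, ?_, by omega, by omega, ?_⟩
    · rw [Nat.coprime_self_add_right, Nat.coprime_two_right]; exact ⟨s, rfl⟩
    · subst h; nlinarith
  · obtain ⟨s, rfl⟩ : ∃ s, r = s + 1 := ⟨r - 1, by omega⟩
    refine ⟨2 * s + 1, 2 * s + 1 + 2 ^ 2, by omega, ?_, by omega, by omega, ?_⟩
    · rw [Nat.coprime_self_add_right]
      apply Nat.Coprime.pow_right
      rw [Nat.coprime_two_right]; exact ⟨s, rfl⟩
    · subst h; nlinarith

theorem large (n : ℕ) (hn : 25 ≤ n) : Concl n := by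
  obtain ⟨k, l, hkl, hc, hk, hl, hP⟩ := exists_kl n hn
  have hnR : (25 : ℝ) ≤ n := by exact_mod_cast hn
  have hn0 : (0 : ℝ) < n := by linarith
  have hPR : (n : ℝ) * n ≤ 4 * (k * l) + 16 := by exact_mod_cast hP
  have hlR : (n : ℝ) ≤ 2 * l := by exact_mod_cast hl
  have hmR : (n : ℝ) < k * l := by nlinarith
  refine main_step k l n hkl hc hk (by omega) (by exact_mod_cast hmR) (14.05 / n) ?_ ?_
  · have h1 : (k : ℝ) * l * (n - 1) / (k * l - n) ^ 2 ≤ 6 / n := by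
      generalize (k : ℝ) * l = P at *
      have hp : 0 < P - n := by linarith
      rw [div_le_div_iff₀ (by positivity) hn0]
      obtain ⟨t, ht, rfl⟩ : ∃ t, 0 ≤ t ∧ P = ((n : ℝ) * n - 16) / 4 + t :=
        ⟨P - ((n : ℝ) * n - 16) / 4, by linarith, by ring⟩
      obtain ⟨s, hs, hs2⟩ : ∃ s : ℝ, 0 ≤ s ∧ (n : ℝ) = 25 + s := ⟨n - 25, by linarith, by ring⟩
      rw [hs2]
      have h0 : 0 ≤ t * s := by positivity
      have h2 : 0 ≤ t * s ^ 2 := by positivity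
      have h3 : 0 ≤ s ^ 2 := by positivity
      have h4 : 0 ≤ s ^ 3 := by positivity
      have h5 : 0 ≤ s ^ 4 := by positivity
      have h6 : 0 ≤ t ^ 2 := by positivity
      nlinarith
    have h2 : (n.descFactorial l : ℝ) / (n : ℝ) ^ l ≤ 8 / n := by
      have hd := desc_bound n (by omega) l (by omega)
      rw [div_le_div_iff₀ (by positivity) hn0]
      have : (n : ℝ) / 8 ≤ 1 + l * (l - 1) / (2 * n) := by
        have : (n : ℝ) / 8 - 1 ≤ l * (l - 1) / (2 * n) := by
          rw [le_div_iff₀ (by positivity)]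
          nlinarith
        linarith
      have hD : (0 : ℝ) ≤ n.descFactorial l := Nat.cast_nonneg _
      have := mul_le_mul_of_nonneg_left this hD
      linarith
    have h3 : 1 / (n : ℝ) ^ 2 ≤ 0.05 / n := by
      rw [div_le_div_iff₀ (by positivity) hn0]
      nlinarith
    have : (14.05 : ℝ) / n = 6 / n + 8 / n + 0.05 / n := by rw [← add_div, ← add_div]; norm_num
    rw [this]; linarith
  · rw [div_pow, div_mul_eq_mul_div, div_le_iff₀ (by positivity)]
    nlinarith

theorem small (n : ℕ) (hn : n ≤ 14) (h1 : 1 ≤ n) : Concl n := by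
  refine ⟨(⊥ : Language (Fin 2)), ?_, ?_, ?_⟩
  · refine ⟨Unit, inferInstance, ⟨fun _ _ => (), (), ∅⟩, ?_⟩
    ext w; rfl
  · refine le_trans (Nat.sInf_le (m := 1) ?_) h1
    refine ⟨Unit, inferInstance, ⟨fun _ _ => (), (), ∅⟩, ?_, rfl⟩
    ext w; rfl
  · have hn0 : (0 : ℝ) < n := by exact_mod_cast h1
    have hnR : (n : ℝ) ≤ 14 := by exact_mod_cast hn
    have h1R : (1 : ℝ) ≤ n := by exact_mod_cast h1
    have hE := Real.exp_one_lt_d9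
    have hE0 := Real.exp_one_gt_d9
    have t1 : ((2 : ℝ) / Real.exp 1) ^ 7 ≤ (2 / Real.exp 1) ^ ((n : ℝ) / 2) := by
      rw [← Real.rpow_natCast]
      apply Real.rpow_le_rpow_of_exponent_ge (by positivity)
      · rw [div_le_one (by positivity)]; linarith
      · push_cast; linarith
    have t2 : (0.1167 : ℝ) ≤ (2 / Real.exp 1) ^ 7 := by
      have : (2 / 2.7182818286 : ℝ) ≤ 2 / Real.exp 1 := by
        apply div_le_div_of_nonneg_left <;> first | positivity | linarith
      refine le_trans ?_ (pow_le_pow_left₀ (by positivity) this 7)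
      norm_num
    have t3 : (1.0868 : ℝ) ≤ Real.exp (1 / 12) := by
      have := Real.quadratic_le_exp_of_nonneg (x := 1 / 12) (by norm_num)
      refine le_trans ?_ this
      norm_num
    have t4 : (1.4142 : ℝ) ≤ Real.sqrt 2 := by
      apply Real.le_sqrt_of_sq_le; norm_num
    have t5 : (0.7559 : ℝ) ≤ Real.sqrt 8 / Real.sqrt n := by
      rw [← Real.sqrt_div (by norm_num)]
      apply Real.le_sqrt_of_sq_le
      rw [le_div_iff₀ hn0]
      nlinarith
    have u1 : (1.4142 : ℝ) * 0.1167 ≤ Real.sqrt 2 * (2 / Real.exp 1) ^ ((n : ℝ) / 2) :=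
      mul_le_mul t4 (t2.trans t1) (by norm_num) (by positivity)
    have u2 : (1.4142 * 0.1167 + 0.7559) * (1.0868 : ℝ) ≤
        (Real.sqrt 2 * (2 / Real.exp 1) ^ ((n : ℝ) / 2) + Real.sqrt 8 / Real.sqrt n) *
          Real.exp (1 / 12) :=
      mul_le_mul (add_le_add u1 t5) t3 (by norm_num) (by positivity)
    have u3 : (1 : ℝ) - Real.sqrt 2 * (2 / Real.exp 1) ^ ((n : ℝ) / 2) * Real.exp (1 / 12)
          - Real.sqrt 8 * Real.exp (1 / 12) / Real.sqrt n ≤ 0 := by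
      have : Real.sqrt 8 * Real.exp (1 / 12) / Real.sqrt n =
        Real.sqrt 8 / Real.sqrt n * Real.exp (1 / 12) := by ring
      rw [this]
      norm_num at u2 ⊢
      linarith
    have u4 := mul_nonpos_of_nonneg_of_nonpos (by positivity : (0 : ℝ) ≤ (n : ℝ) ^ n) u3
    have h4 : (0 : ℝ) ≤ (n : ℝ) * ((n : ℝ) - 1) / 2 := by
      have : 0 ≤ (n : ℝ) - 1 := by linarith
      positivity
    have h6 : (0 : ℝ) ≤ (sc (root (⊥ : Language (Fin 2))) : ℝ) := Nat.cast_nonneg _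
    rw [ge_iff_le]
    linarith

theorem medium (n : ℕ) (h1 : 15 ≤ n) (h2 : n ≤ 24) : Concl n := by
  interval_cases n
  · apply main_step 7 8 15 rfl (by norm_num) (by norm_num) (by norm_num) (by norm_num) _ le_rfl
    norm_num [Nat.descFactorial]
  · apply main_step 7 9 16 rfl (by norm_num) (by norm_num) (by norm_num) (by norm_num) _ le_rfl
    norm_num [Nat.descFactorial]
  · apply main_step 8 9 17 rfl (by norm_num) (by norm_num) (by norm_num) (by norm_num) _ le_rfl
    norm_num [Nat.descFactorial]
  · apply main_step 7 11 18 rfl (by norm_num) (by norm_num) (by norm_num) (by norm_num) _ le_rfl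
    norm_num [Nat.descFactorial]
  · apply main_step 9 10 19 rfl (by norm_num) (by norm_num) (by norm_num) (by norm_num) _ le_rfl
    norm_num [Nat.descFactorial]
  · apply main_step 9 11 20 rfl (by norm_num) (by norm_num) (by norm_num) (by norm_num) _ le_rfl
    norm_num [Nat.descFactorial]
  · apply main_step 10 11 21 rfl (by norm_num) (by norm_num) (by norm_num) (by norm_num) _ le_rfl
    norm_num [Nat.descFactorial]
  · apply main_step 9 13 22 rfl (by norm_num) (by norm_num) (by norm_num) (by norm_num) _ le_rfl
    norm_num [Nat.descFactorial]
  · apply main_step 11 12 23 rfl (by norm_num) (by norm_num) (by norm_num) (by norm_num) _ le_rfl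
    norm_num [Nat.descFactorial]
  · apply main_step 11 13 24 rfl (by norm_num) (by norm_num) (by norm_num) (by norm_num) _ le_rfl
    norm_num [Nat.descFactorial]

end RootSC

/-- **Corollary 3.18.** For `n ≥ 7` there is a regular language `L` over a two-letter
alphabet with `sc L ≤ n` and
`sc (root L) ≥ n^n (1 - √2 (2/e)^(n/2) e^(1/12) - √8 e^(1/12)/√n) - n(n-1)/2`. -/
theorem corollary_3_18 (n : ℕ) (hn : 7 ≤ n) :
    ∃ L : Language (Fin 2), IsReg L ∧ sc L ≤ n ∧
      ((sc (root L) : ℝ) ≥ (n : ℝ) ^ n *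
        (1 - Real.sqrt 2 * (2 / Real.exp 1) ^ ((n : ℝ) / 2) * Real.exp (1 / 12)
          - Real.sqrt 8 * Real.exp (1 / 12) / Real.sqrt n)
        - (n : ℝ) * ((n : ℝ) - 1) / 2) := by
  rcases Nat.lt_or_ge n 15 with h | h
  · exact RootSC.small n (by omega) (by omega)
  · rcases Nat.lt_or_ge n 25 with h2 | h2
    · exact RootSC.medium n h (by omega)
    · exact RootSC.large n h2
end
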